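/- arXiv:1605.00903 — 2 statements merged into one kernel-verified Lean document; each statement's English description precedes it below -/
import Mathlib

section
/- Let q be even with q/4 a power of 2, let p be a positive integer, and let B be the row-column symmetrized matrix built from a random 3-tensor A with i.i.d. entries uniform on {−1,+1}. Then for all I^1,…,I^p ∈ [n]^{q/2}: (1) E(I^1,…,I^p) ≥ 0; (2) if E(I^1,…,I^p) ≠ 0, then the number N(I^1,…,I^p) of distinct elements of [n] occurring among the coordinates of I^1,…,I^p is at most pq/4 + q/2. -/
open scoped BigOperators

noncomputable section

/-- The ±1-valued tensor associated with a Boolean sign pattern. -/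
def signT {n d : ℕ} (A : (Fin d → Fin n) → Bool) : (Fin d → Fin n) → ℝ :=
  fun K => if A K then 1 else -1

/-- Expectation of `g` over a random order-`d` tensor with i.i.d. uniform ±1 entries. -/
def texp (n d : ℕ) (g : ((Fin d → Fin n) → ℝ) → ℝ) : ℝ :=
  (∑ A : (Fin d → Fin n) → Bool, g (signT A)) / (Fintype.card ((Fin d → Fin n) → Bool) : ℝ)

/-- Probability of event `P` over a random order-`d` tensor with i.i.d. uniform ±1 entries. -/
def tprob (n d : ℕ) (P : ((Fin d → Fin n) → ℝ) → Prop) : ℝ :=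
  (Nat.card {A : (Fin d → Fin n) → Bool // P (signT A)} : ℝ) /
    (Fintype.card ((Fin d → Fin n) → Bool) : ℝ)

/-- Operator (ℓ₂→ℓ₂) norm of a rectangular array, as the sup of `|uᵀ M v|` over unit vectors. -/
def opNorm {ι κ : Type*} [Fintype ι] [Fintype κ] (M : ι → κ → ℝ) : ℝ :=
  sSup {r : ℝ | ∃ (u : EuclideanSpace ℝ ι) (v : EuclideanSpace ℝ κ),
    ‖u‖ = 1 ∧ ‖v‖ = 1 ∧ r = |∑ i, ∑ j, u i * M i j * v j|}

/-- Largest eigenvalue of a symmetric array, as the sup of Rayleigh quotients. -/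
def lamMax {ι : Type*} [Fintype ι] (M : ι → ι → ℝ) : ℝ :=
  sSup {r : ℝ | ∃ y : EuclideanSpace ℝ ι, ‖y‖ = 1 ∧ r = ∑ i, ∑ j, y i * M i j * y j}

/-- Number of occurrences of `v` among the coordinates of the tuple `I`. -/
def cnt {n k : ℕ} (I : Fin k → Fin n) (v : Fin n) : ℕ :=
  (Finset.univ.filter fun ℓ => I ℓ = v).card

/-- The set `O(δ)` of tuples whose multi-index is `δ`. -/
def Oset (n k : ℕ) (δ : Fin n → ℕ) : Finset (Fin k → Fin n) :=
  Finset.univ.filter fun K => ∀ v, cnt K v = δ v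

/-- The set of elements of `[n]` occurring among the coordinates of `I¹, …, Iᵖ`. -/
def occSet {n h p : ℕ} (I : Fin p → Fin h → Fin n) : Finset (Fin n) :=
  Finset.univ.filter fun v => ∃ ℓ j, I ℓ j = v

/-- Membership in the class `𝒞(c¹,…,cˢ)`: there are exactly `s` distinct occurring
elements and the `k`-th smallest occurring element appears `c k ℓ` times in `Iˡ`. -/
def inC {n h p s : ℕ} (c : Fin s → Fin p → ℕ) (I : Fin p → Fin h → Fin n) : Prop :=
  ∃ hcard : (occSet I).card = s,
    ∀ (k : Fin s) (ℓ : Fin p),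
      cnt (I ℓ) (((occSet I).orderIsoOfFin hcard k : Fin n)) = c k ℓ

/-- Concatenation of two half-tuples of length `d/2` into a tuple of length `d` (`d` even). -/
def halfConcat {n : ℕ} (d : ℕ) (hd : d % 2 = 0) (K₁ K₂ : Fin (d / 2) → Fin n) :
    Fin d → Fin n :=
  fun t => if h : (t : ℕ) < d / 2 then K₁ ⟨t, h⟩
           else K₂ ⟨(t : ℕ) - d / 2, by have ht := t.isLt; omega⟩

/-- The position in `[q/2]` of the `r`-th entry of the `m`-th block of length `d/2`. -/
def blockIdx (d q : ℕ) (m : Fin (q / d)) (r : Fin (d / 2)) : Fin (q / 2) :=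
  ⟨(m : ℕ) * (d / 2) + (r : ℕ), by
    have hm : (m : ℕ) < q / d := m.isLt
    have hr : (r : ℕ) < d / 2 := r.isLt
    have h3 : q / d * (d / 2) ≤ q / 2 := by
      have h4 : q / d * d ≤ q := Nat.div_mul_le_self q d
      have h6 : q / d * (d / 2) * 2 ≤ q / d * d := by
        have h5 : d / 2 * 2 ≤ d := by omega
        calc q / d * (d / 2) * 2 = q / d * (d / 2 * 2) := by ring
          _ ≤ q / d * d := Nat.mul_le_mul (le_refl _) h5
      omega
    have h7 : ((m : ℕ) + 1) * (d / 2) ≤ q / d * (d / 2) :=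
      Nat.mul_le_mul (by omega) (le_refl _)
    have h8 : ((m : ℕ) + 1) * (d / 2) = (m : ℕ) * (d / 2) + d / 2 := by ring
    omega⟩

/-- Row-column independent symmetrization of `A^{⊗ q/d}`. -/
def rcSym (n d q : ℕ) (hd : d % 2 = 0) (A : (Fin d → Fin n) → ℝ)
    (I J : Fin (q / 2) → Fin n) : ℝ :=
  ((Nat.factorial (q / 2) : ℝ))⁻¹ ^ 2 *
    ∑ π : Equiv.Perm (Fin (q / 2)), ∑ σ : Equiv.Perm (Fin (q / 2)),
      ∏ m : Fin (q / d),
        A (halfConcat d hd (fun r => I (π (blockIdx d q m r)))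
            (fun r => J (σ (blockIdx d q m r))))

/-- `E(I¹,…,Iᵖ) = 𝔼[∏_ℓ M[Iˡ, Iˡ⁺¹]]` (cyclically). -/
def Efun (n d q p : ℕ) (hd : d % 2 = 0) (hp : p ≠ 0)
    (I : Fin p → Fin (q / 2) → Fin n) : ℝ :=
  haveI : NeZero p := ⟨hp⟩
  texp n d fun A => ∏ ℓ : Fin p, rcSym n d q hd A (I ℓ) (I (ℓ + 1))

/-- `Tr(M^p)` for the row-column independent symmetrization `M` of `A^{⊗ q/d}`. -/
def trMpow (n d q p : ℕ) (hd : d % 2 = 0) (hp : p ≠ 0)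
    (A : (Fin d → Fin n) → ℝ) : ℝ :=
  haveI : NeZero p := ⟨hp⟩
  ∑ I : Fin p → Fin (q / 2) → Fin n, ∏ ℓ : Fin p, rcSym n d q hd A (I ℓ) (I (ℓ + 1))

/-- `𝒯 = Σ_ℓ T_ℓ ⊗ T_ℓ`, where `T_ℓ` is the symmetrized `ℓ`-th slice of the 3-tensor `A`. -/
def calT (n : ℕ) (A : (Fin 3 → Fin n) → ℝ) (u v : Fin n × Fin n) : ℝ :=
  ∑ ℓ : Fin n,
    ((A ![ℓ, u.1, v.1] + A ![ℓ, v.1, u.1]) / 2) *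
    ((A ![ℓ, u.2, v.2] + A ![ℓ, v.2, u.2]) / 2)

/-- `T = 𝒯 - D`, where `D` is the restriction of `𝒯` to entries `[(i,i),(j,j)]`. -/
def Tmat (n : ℕ) (A : (Fin 3 → Fin n) → ℝ) (u v : Fin n × Fin n) : ℝ :=
  calT n A u v - (if u.1 = u.2 ∧ v.1 = v.2 then calT n A u v else 0)

/-- The position in `[q/2]` of the `r`-th entry of the `g`-th pair. -/
def pairIdx (q : ℕ) (g : Fin (q / 4)) (r : Fin 2) : Fin (q / 2) :=
  ⟨2 * (g : ℕ) + (r : ℕ), by have hg := g.isLt; have hr := r.isLt; omega⟩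

/-- `𝖠 = T^{⊗ q/4}` as a `[n]^{q/2} × [n]^{q/2}` array. -/
def bigA3 (n q : ℕ) (A : (Fin 3 → Fin n) → ℝ) (I J : Fin (q / 2) → Fin n) : ℝ :=
  ∏ g : Fin (q / 4),
    Tmat n A (I (pairIdx q g 0), I (pairIdx q g 1)) (J (pairIdx q g 0), J (pairIdx q g 1))

/-- The row-column symmetrized matrix `B`. -/
def Bmat (n q : ℕ) (A : (Fin 3 → Fin n) → ℝ) (I J : Fin (q / 2) → Fin n) : ℝ :=
  ((Nat.factorial (q / 2) : ℝ))⁻¹ ^ 2 *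
    ∑ π : Equiv.Perm (Fin (q / 2)), ∑ σ : Equiv.Perm (Fin (q / 2)),
      bigA3 n q A (fun t => I (π t)) (fun t => J (σ t))

/-- `E(I¹,…,Iᵖ) = 𝔼[∏_ℓ B[Iˡ, Iˡ⁺¹]]` (cyclically), for the 3-tensor case. -/
def E3fun (n q p : ℕ) (hp : p ≠ 0) (I : Fin p → Fin (q / 2) → Fin n) : ℝ :=
  haveI : NeZero p := ⟨hp⟩
  texp n 3 fun A => ∏ ℓ : Fin p, Bmat n q A (I ℓ) (I (ℓ + 1))

/-- Concatenation of two tuples of length `q/2` into a tuple of length `q` (`q` even). -/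
def tupConcat {n : ℕ} (q : ℕ) (hq : q % 2 = 0) (I J : Fin (q / 2) → Fin n) :
    Fin q → Fin n :=
  fun t => if h : (t : ℕ) < q / 2 then I ⟨t, h⟩
           else J ⟨(t : ℕ) - q / 2, by have ht := t.isLt; omega⟩

end

open scoped BigOperators

/-- Nonnegative multiples of monomials in the sign variables. -/
def monoSub (n d : ℕ) : Submonoid (((Fin d → Fin n) → Bool) → ℝ) where
  carrier := {f | ∃ c : ℝ, 0 ≤ c ∧ ∃ e : (Fin d → Fin n) → ℕ,
    f = fun A => c * ∏ x, signT A x ^ e x}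
  one_mem' := ⟨1, by norm_num, fun _ => 0, by funext A; simp⟩
  mul_mem' := by
    rintro f g ⟨c, hc, e, rfl⟩ ⟨c', hc', e', rfl⟩
    refine ⟨c * c', mul_nonneg hc hc', fun x => e x + e' x, ?_⟩
    funext A
    simp only [Pi.mul_apply, pow_add, Finset.prod_mul_distrib]
    ring

/-- Polynomials with nonnegative coefficients in the sign variables. -/
def posS (n d : ℕ) : Subsemiring (((Fin d → Fin n) → Bool) → ℝ) :=
  Subsemiring.closure (monoSub n d : Set (((Fin d → Fin n) → Bool) → ℝ))

lemma posS_sum_nonneg {n d : ℕ} {f : ((Fin d → Fin n) → Bool) → ℝ} (hf : f ∈ posS n d) :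
    0 ≤ ∑ A, f A := by
  unfold posS at hf
  rw [Subsemiring.mem_closure_iff, Submonoid.closure_eq] at hf
  induction hf using AddSubmonoid.closure_induction with
  | mem f hf =>
    obtain ⟨c, hc, e, rfl⟩ := hf
    rw [← Finset.mul_sum]
    refine mul_nonneg hc ?_
    have h := Finset.prod_univ_sum (fun _ : Fin d → Fin n => (Finset.univ : Finset Bool))
      (fun x b => (if b then (1 : ℝ) else -1) ^ e x)
    rw [Fintype.piFinset_univ] at h
    unfold signT
    rw [← h]
    refine Finset.prod_nonneg fun x _ => ?_
    rw [Fintype.sum_bool]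
    rcases neg_one_pow_eq_or ℝ (e x) with h | h <;> simp [h]
  | zero => simp
  | add f g _ _ hf hg =>
    simp only [Pi.add_apply, Finset.sum_add_distrib]
    exact add_nonneg hf hg

lemma posS_const {n d : ℕ} (c : ℝ) (hc : 0 ≤ c) : (fun _ => c) ∈ posS n d :=
  Subsemiring.subset_closure ⟨c, hc, fun _ => 0, by funext A; simp⟩

lemma posS_var {n d : ℕ} (x : Fin d → Fin n) : (fun A => signT A x) ∈ posS n d := by
  classical
  refine Subsemiring.subset_closure ⟨1, by norm_num, fun y => if y = x then 1 else 0, ?_⟩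
  funext A
  simp [pow_ite]

lemma posS_mul {n d : ℕ} {f g : ((Fin d → Fin n) → Bool) → ℝ} (hf : f ∈ posS n d)
    (hg : g ∈ posS n d) : (fun A => f A * g A) ∈ posS n d := mul_mem hf hg

lemma posS_add {n d : ℕ} {f g : ((Fin d → Fin n) → Bool) → ℝ} (hf : f ∈ posS n d)
    (hg : g ∈ posS n d) : (fun A => f A + g A) ∈ posS n d := add_mem hf hg

lemma posS_sum {n d : ℕ} {ι : Type*} [Fintype ι] {f : ι → ((Fin d → Fin n) → Bool) → ℝ}
    (hf : ∀ i, f i ∈ posS n d) : (fun A => ∑ i, f i A) ∈ posS n d := by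
  have h : (∑ i, f i) ∈ posS n d := sum_mem fun i _ => hf i
  convert h using 1
  funext A
  simp

lemma posS_prod {n d : ℕ} {ι : Type*} [Fintype ι] {f : ι → ((Fin d → Fin n) → Bool) → ℝ}
    (hf : ∀ i, f i ∈ posS n d) : (fun A => ∏ i, f i A) ∈ posS n d := by
  have h : (∏ i, f i) ∈ posS n d := prod_mem fun i _ => hf i
  convert h using 1
  funext A
  simp

lemma posS_calT {n : ℕ} (u v : Fin n × Fin n) : (fun A => calT n (signT A) u v) ∈ posS n 3 := by
  unfold calT
  refine posS_sum fun l => posS_mul ?_ ?_ <;> simp only [div_eq_mul_inv] <;>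
    exact posS_mul (posS_add (posS_var _) (posS_var _)) (posS_const _ (by norm_num))

lemma posS_Tmat {n : ℕ} (u v : Fin n × Fin n) : (fun A => Tmat n (signT A) u v) ∈ posS n 3 := by
  unfold Tmat
  by_cases h : u.1 = u.2 ∧ v.1 = v.2
  · simp only [h, and_self, if_true, sub_self]
    exact posS_const 0 le_rfl
  · simp only [h, if_false, sub_zero]
    exact posS_calT u v

lemma posS_Bmat {n q : ℕ} (I J : Fin (q / 2) → Fin n) :
    (fun A => Bmat n q (signT A) I J) ∈ posS n 3 := by
  unfold Bmat
  refine posS_mul (posS_const _ (by positivity)) ?_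
  refine posS_sum fun π => posS_sum fun σ => ?_
  unfold bigA3
  exact posS_prod fun g => posS_Tmat _ _

/-- Flip the sign of all entries lying over the unordered edge `z`. -/
def flipE {n : ℕ} (z : Sym2 (Fin n)) (A : (Fin 3 → Fin n) → Bool) : (Fin 3 → Fin n) → Bool :=
  fun K => if s(K 1, K 2) = z then !(A K) else A K

lemma flipE_invol {n : ℕ} (z : Sym2 (Fin n)) : Function.Involutive (flipE z) := by
  intro A
  funext K
  unfold flipE
  split_ifs <;> simp

/-- The sign attached to an edge. -/
def epsE {n : ℕ} (z w : Sym2 (Fin n)) : ℝ := if w = z then -1 else 1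

lemma signT_flip {n : ℕ} (z : Sym2 (Fin n)) (A : (Fin 3 → Fin n) → Bool) (a b c : Fin n) :
    signT (flipE z A) ![a, b, c] = epsE z s(b, c) * signT A ![a, b, c] := by
  unfold signT flipE epsE
  by_cases h : s(b, c) = z <;> cases hA : A ![a, b, c] <;> simp [h, hA]

lemma calT_flip {n : ℕ} (z : Sym2 (Fin n)) (A : (Fin 3 → Fin n) → Bool) (u v : Fin n × Fin n) :
    calT n (signT (flipE z A)) u v =
      (epsE z s(u.1, v.1) * epsE z s(u.2, v.2)) * calT n (signT A) u v := by
  unfold calT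
  rw [Finset.mul_sum]
  refine Finset.sum_congr rfl fun l _ => ?_
  rw [signT_flip, signT_flip, signT_flip, signT_flip, Sym2.eq_swap (a := v.1),
    Sym2.eq_swap (a := v.2)]
  ring

lemma Tmat_flip {n : ℕ} (z : Sym2 (Fin n)) (A : (Fin 3 → Fin n) → Bool) (u v : Fin n × Fin n) :
    Tmat n (signT (flipE z A)) u v =
      (epsE z s(u.1, v.1) * epsE z s(u.2, v.2)) * Tmat n (signT A) u v := by
  unfold Tmat
  rw [calT_flip]
  split_ifs <;> ring

lemma bigA3_flip {n q : ℕ} (z : Sym2 (Fin n)) (A : (Fin 3 → Fin n) → Bool)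
    (I J : Fin (q / 2) → Fin n) :
    bigA3 n q (signT (flipE z A)) I J =
      (∏ g : Fin (q / 4), ∏ r : Fin 2, epsE z s(I (pairIdx q g r), J (pairIdx q g r))) *
        bigA3 n q (signT A) I J := by
  unfold bigA3
  rw [← Finset.prod_mul_distrib]
  refine Finset.prod_congr rfl fun g _ => ?_
  rw [Tmat_flip, Fin.prod_univ_two]

/-- If the expectation of a product of entries of `𝖠` is nonzero, every edge has even
multiplicity. -/
lemma even_of_ne {n q p : ℕ} (I J : Fin p → Fin (q / 2) → Fin n)
    (h : ∑ A : (Fin 3 → Fin n) → Bool, ∏ l, bigA3 n q (signT A) (I l) (J l) ≠ 0)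
    (z : Sym2 (Fin n)) :
    Even (Finset.univ.filter fun e : Fin p × Fin (q / 4) × Fin 2 =>
      s(I e.1 (pairIdx q e.2.1 e.2.2), J e.1 (pairIdx q e.2.1 e.2.2)) = z).card := by
  by_contra hodd
  rw [Nat.not_even_iff_odd] at hodd
  apply h
  have h1 : ∀ A : (Fin 3 → Fin n) → Bool,
      ∏ l, bigA3 n q (signT (flipE z A)) (I l) (J l) =
        - ∏ l, bigA3 n q (signT A) (I l) (J l) := by
    intro A
    simp only [bigA3_flip]
    rw [Finset.prod_mul_distrib]
    have h2 : (∏ l : Fin p, ∏ g : Fin (q / 4), ∏ r : Fin 2,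
        epsE z s(I l (pairIdx q g r), J l (pairIdx q g r))) = -1 := by
      rw [← hodd.neg_one_pow (α := ℝ)]
      simp only [← Fintype.prod_prod_type']
      unfold epsE
      rw [Finset.prod_ite]
      simp
    rw [h2]
    ring
  have h3 := Equiv.sum_comp (flipE_invol z).toPerm
    (fun A => ∏ l, bigA3 n q (signT A) (I l) (J l))
  simp only [Function.Involutive.coe_toPerm, h1, Finset.sum_neg_distrib] at h3
  linarith

lemma exists_of_ne {n q p : ℕ} (I J : Fin p → Fin (q / 2) → Fin n)
    (h : ∑ A : (Fin 3 → Fin n) → Bool, ∏ l, Bmat n q (signT A) (I l) (J l) ≠ 0) :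
    ∃ π σ : Fin p → Equiv.Perm (Fin (q / 2)),
      ∑ A : (Fin 3 → Fin n) → Bool, ∏ l, bigA3 n q (signT A)
        (fun t => I l (π l t)) (fun t => J l (σ l t)) ≠ 0 := by
  by_contra! hc
  apply h
  have hB : ∀ A : (Fin 3 → Fin n) → Bool, ∏ l, Bmat n q (signT A) (I l) (J l) =
      (∏ _l : Fin p, ((Nat.factorial (q / 2) : ℝ))⁻¹ ^ 2) *
        ∑ w : Fin p → Equiv.Perm (Fin (q / 2)) × Equiv.Perm (Fin (q / 2)),
          ∏ l, bigA3 n q (signT A) (fun t => I l ((w l).1 t)) (fun t => J l ((w l).2 t)) := by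
    intro A
    unfold Bmat
    rw [Finset.prod_mul_distrib]
    congr 1
    simp only [← Fintype.sum_prod_type']
    rw [Finset.prod_univ_sum, Fintype.piFinset_univ]
  simp only [hB]
  rw [← Finset.mul_sum, Finset.sum_comm]
  refine mul_eq_zero_of_right _ (Finset.sum_eq_zero fun w _ => ?_)
  exact hc (fun l => (w l).1) (fun l => (w l).2)

lemma pairIdx_surj {q : ℕ} (hq : q % 4 = 0) (t : Fin (q / 2)) :
    ∃ g r, pairIdx q g r = t := by
  have ht := t.isLt
  refine ⟨⟨t / 2, by omega⟩, ⟨t % 2, by omega⟩, ?_⟩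
  apply Fin.ext
  simp only [pairIdx]
  omega

lemma count_bound {n q p : ℕ} (hq : q % 4 = 0) [NeZero p] (I : Fin p → Fin (q / 2) → Fin n)
    (π σ : Fin p → Equiv.Perm (Fin (q / 2)))
    (hev : ∀ z : Sym2 (Fin n), Even (Finset.univ.filter fun e : Fin p × Fin (q / 4) × Fin 2 =>
      s(I e.1 (π e.1 (pairIdx q e.2.1 e.2.2)),
        I (e.1 + 1) (σ e.1 (pairIdx q e.2.1 e.2.2))) = z).card) :
    2 * (occSet I).card ≤ 2 * (q / 2) + p * (q / 2) := by
  classical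
  set ed : Fin p × Fin (q / 4) × Fin 2 → Sym2 (Fin n) := fun e =>
    s(I e.1 (π e.1 (pairIdx q e.2.1 e.2.2)),
        I (e.1 + 1) (σ e.1 (pairIdx q e.2.1 e.2.2))) with hed
  have himg : 2 * (Finset.univ.image ed).card ≤ p * (q / 2) := by
    have h := Finset.mul_card_image_le_card_of_maps_to (s := Finset.univ) (f := ed)
      (t := Finset.univ.image ed) (fun a ha => Finset.mem_image_of_mem _ ha) 2 (by
        intro z hz
        obtain ⟨e, _, he⟩ := Finset.mem_image.1 hz
        obtain ⟨m, hm⟩ := hev z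
        have hpos : 0 < (Finset.univ.filter fun e => ed e = z).card :=
          Finset.card_pos.2 ⟨e, by simpa using he⟩
        have hm' : (Finset.univ.filter fun e => ed e = z).card = m + m := hm
        omega)
    refine h.trans (le_of_eq ?_)
    simp only [Finset.card_univ, Fintype.card_prod, Fintype.card_fin]
    congr 1
    omega
  let lev : Fin n → ℕ := fun v => sInf {l : ℕ | ∃ h : l < p, ∃ j, I ⟨l, h⟩ j = v}
  have hp : 0 < p := Nat.pos_of_ne_zero (NeZero.ne p)
  have hex : ∀ v ∈ occSet I \ Finset.univ.image (I ⟨0, hp⟩),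
      ∃ u, s(u, v) ∈ Finset.univ.image ed ∧ lev u < lev v := by
    intro v hv
    simp only [Finset.mem_sdiff, occSet, Finset.mem_filter, Finset.mem_univ, true_and,
      Finset.mem_image, not_exists] at hv
    obtain ⟨⟨l, j, hlj⟩, hv0⟩ := hv
    have hne : {l : ℕ | ∃ h : l < p, ∃ j, I ⟨l, h⟩ j = v}.Nonempty := ⟨l, l.isLt, j, hlj⟩
    obtain ⟨h1, j1, hj1⟩ := Nat.sInf_mem hne
    change ∃ u, _ ∧ lev u < lev v
    have hlev : sInf {l : ℕ | ∃ h : l < p, ∃ j, I ⟨l, h⟩ j = v} = lev v := rfl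
    generalize hm : sInf {l : ℕ | ∃ h : l < p, ∃ j, I ⟨l, h⟩ j = v} = m at *
    rw [← hlev]
    rcases m with _ | m
    · exact absurd hj1 (hv0 j1)
    · have hmp : m < p := by omega
      have hsucc : (⟨m, hmp⟩ : Fin p) + 1 = ⟨m + 1, h1⟩ := by
        apply Fin.ext
        rw [Fin.val_add, Fin.val_one', Nat.add_mod_mod, Nat.mod_eq_of_lt h1]
      obtain ⟨g, r, hgr⟩ := pairIdx_surj hq ((σ ⟨m, hmp⟩).symm j1)
      refine ⟨I ⟨m, hmp⟩ (π ⟨m, hmp⟩ (pairIdx q g r)), ?_, ?_⟩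
      · refine Finset.mem_image.2 ⟨(⟨m, hmp⟩, g, r), Finset.mem_univ _, ?_⟩
        simp only [hed, hgr, hsucc, Equiv.apply_symm_apply, hj1]
      · exact Nat.lt_succ_of_le (Nat.sInf_le ⟨hmp, _, rfl⟩)
  choose! par hpar1 hpar2 using hex
  have hinj : (occSet I \ Finset.univ.image (I ⟨0, hp⟩)).card ≤ (Finset.univ.image ed).card := by
    refine Finset.card_le_card_of_injOn (fun v => s(par v, v)) (fun v hv => hpar1 v hv) ?_
    intro v hv w hw hvw
    have a := hpar2 v hv
    have b := hpar2 w hw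
    simp only [Sym2.eq_iff] at hvw
    rcases hvw with ⟨_, h⟩ | ⟨h, h'⟩
    · exact h
    · rw [h] at a
      rw [← h'] at b
      omega
  have h0 : (Finset.univ.image (I ⟨0, hp⟩)).card ≤ q / 2 := by
    refine Finset.card_image_le.trans ?_
    simp
  have h1 := Finset.le_card_sdiff (Finset.univ.image (I ⟨0, hp⟩)) (occSet I)
  omega

theorem stmt_16 (n q p k : ℕ) (hq : q = 4 * 2 ^ k) (hp : 1 ≤ p)
    (I : Fin p → Fin (q / 2) → Fin n) :
    0 ≤ E3fun n q p (by omega) I ∧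
    (E3fun n q p (by omega) I ≠ 0 →
      ((occSet I).card : ℝ) ≤ (p : ℝ) * (q : ℝ) / 4 + (q : ℝ) / 2) := by
  haveI : NeZero p := ⟨by omega⟩
  constructor
  · unfold E3fun texp
    refine div_nonneg (posS_sum_nonneg ?_) (by positivity)
    exact posS_prod fun l => posS_Bmat _ _
  · intro hE
    have hq4 : q % 4 = 0 := by omega
    have hE' : ∑ A : (Fin 3 → Fin n) → Bool,
        ∏ l, Bmat n q (signT A) (I l) (I (l + 1)) ≠ 0 := by
      intro h0
      apply hE
      unfold E3fun texp
      rw [h0, zero_div]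
    obtain ⟨π, σ, h⟩ := exists_of_ne I (fun l => I (l + 1)) hE'
    have hev := even_of_ne _ _ h
    have hb := count_bound hq4 I π σ hev
    obtain ⟨m, rfl⟩ : ∃ m, q = 4 * m := ⟨2 ^ k, hq⟩
    have e : 4 * m / 2 = 2 * m := by omega
    simp only [e] at hb
    have hb' : (2 : ℝ) * ((occSet I).card : ℝ) ≤ 2 * (2 * m) + p * (2 * m) := by
      exact_mod_cast hb
    push_cast
    linarith
end

section
/- There exist absolute constants C, c > 0 such that for all n ≥ C and all even q with q/4 a power of 2 and q·log n ≤ n, the following holds with probability at least 1 − n^{−c} over a random 3-tensor A with i.i.d. entries uniform on {−1,+1}: the row-column symmetrized matrix B satisfies ‖B‖₂^{4/q} ≤ n^{3/2}·(log n)^5 / √q. -/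
open scoped BigOperators

namespace KB
open Finset Matrix

/-- squared Euclidean norm -/
def nsq {d : Type*} [Fintype d] (w : d → ℝ) : ℝ := w ⬝ᵥ w

lemma nsq_nonneg {d : Type*} [Fintype d] (w : d → ℝ) : 0 ≤ nsq w := by
  unfold nsq dotProduct
  exact Finset.sum_nonneg fun i _ => mul_self_nonneg _

lemma pair_pow_le (x y : ℝ) (a b : ℕ) (h : Even (a + b)) :
    x ^ a * y ^ b + x ^ b * y ^ a ≤ x ^ (a + b) + y ^ (a + b) := by
  have h1 : x ^ (a+b) = |x| ^ (a+b) := (h.pow_abs x).symm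
  have h2 : y ^ (a+b) = |y| ^ (a+b) := (h.pow_abs y).symm
  have h3 : x ^ a * y ^ b ≤ |x| ^ a * |y| ^ b := by
    rw [← abs_pow, ← abs_pow, ← abs_mul]; exact le_abs_self _
  have h4 : x ^ b * y ^ a ≤ |x| ^ b * |y| ^ a := by
    rw [← abs_pow, ← abs_pow, ← abs_mul]; exact le_abs_self _
  rw [h1, h2]
  have hx := abs_nonneg x
  have hy := abs_nonneg y
  have key : 0 ≤ (|x| ^ a - |y| ^ a) * (|x| ^ b - |y| ^ b) := by
    rcases le_total (|x|) (|y|) with hxy | hxy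
    · have e1 := pow_le_pow_left₀ hx hxy a
      have e2 := pow_le_pow_left₀ hx hxy b
      nlinarith
    · have e1 := pow_le_pow_left₀ hy hxy a
      have e2 := pow_le_pow_left₀ hy hxy b
      nlinarith
  rw [pow_add, pow_add]
  nlinarith

lemma sum_pow_le (x y : ℝ) (s : ℕ) (hs : Even s) :
    ∑ q ∈ range (s + 1), x ^ q * y ^ (s - q) ≤ ((s : ℝ) + 1) / 2 * (x ^ s + y ^ s) := by
  have h1 : ∑ q ∈ range (s + 1), x ^ q * y ^ (s - q)
      = ∑ q ∈ range (s + 1), x ^ (s - q) * y ^ q := by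
    rw [← Finset.sum_range_reflect]
    refine Finset.sum_congr rfl fun q hq => ?_
    have : q ≤ s := by simpa [Nat.lt_succ_iff] using hq
    congr 2 <;> omega
  have h2 : ∑ q ∈ range (s + 1), (x ^ q * y ^ (s - q) + x ^ (s - q) * y ^ q)
      ≤ ∑ q ∈ range (s + 1), (x ^ s + y ^ s) := by
    refine Finset.sum_le_sum fun q hq => ?_
    have : q ≤ s := by simpa [Nat.lt_succ_iff] using hq
    have e : q + (s - q) = s := by omega
    have := pair_pow_le x y q (s - q) (by rw [e]; exact hs)
    rwa [e] at this
  rw [Finset.sum_add_distrib, ← h1, Finset.sum_const, card_range, nsmul_eq_mul] at h2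
  push_cast at h2
  linarith

variable {d : Type*} [Fintype d] [DecidableEq d]

lemma spectral (X : Matrix d d ℝ) (hX : Xᵀ = X) :
    ∃ (U : Matrix d d ℝ) (l : d → ℝ), U * Uᵀ = 1 ∧ Uᵀ * U = 1 ∧
      ∀ q : ℕ, X ^ q = U * diagonal (fun a => l a ^ q) * Uᵀ := by
  have hH : X.IsHermitian := by
    rw [Matrix.IsHermitian, conjTranspose_eq_transpose_of_trivial, hX]
  refine ⟨(hH.eigenvectorUnitary : Matrix d d ℝ), hH.eigenvalues, ?_, ?_, ?_⟩
  · have := (mem_unitaryGroup_iff (A := (hH.eigenvectorUnitary : Matrix d d ℝ))).1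
      hH.eigenvectorUnitary.2
    rwa [star_eq_conjTranspose, conjTranspose_eq_transpose_of_trivial] at this
  · have := (mem_unitaryGroup_iff' (A := (hH.eigenvectorUnitary : Matrix d d ℝ))).1
      hH.eigenvectorUnitary.2
    rwa [star_eq_conjTranspose, conjTranspose_eq_transpose_of_trivial] at this
  · have hU := (mem_unitaryGroup_iff' (A := (hH.eigenvectorUnitary : Matrix d d ℝ))).1
      hH.eigenvectorUnitary.2
    rw [star_eq_conjTranspose, conjTranspose_eq_transpose_of_trivial] at hU
    have hU' := (mem_unitaryGroup_iff (A := (hH.eigenvectorUnitary : Matrix d d ℝ))).1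
      hH.eigenvectorUnitary.2
    rw [star_eq_conjTranspose, conjTranspose_eq_transpose_of_trivial] at hU'
    have hS := hH.spectral_theorem
    rw [Unitary.conjStarAlgAut_apply, star_eq_conjTranspose,
      conjTranspose_eq_transpose_of_trivial] at hS
    set U := (hH.eigenvectorUnitary : Matrix d d ℝ)
    have hd : diagonal (RCLike.ofReal ∘ hH.eigenvalues : d → ℝ) = diagonal hH.eigenvalues := by
      congr 1
    rw [hd] at hS
    intro q
    induction q with
    | zero => simp [hU']
    | succ q ih =>
      rw [pow_succ, ih]
      have : (diagonal fun a => hH.eigenvalues a ^ (q+1)) =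
        diagonal (fun a => hH.eigenvalues a ^ q) * diagonal hH.eigenvalues := by
        rw [diagonal_mul_diagonal]; simp [pow_succ]
      rw [this]
      calc _ = U * diagonal (fun a => hH.eigenvalues a ^ q) * Uᵀ *
            (U * diagonal hH.eigenvalues * Uᵀ) := by rw [← hS]
        _ = U * diagonal (fun a => hH.eigenvalues a ^ q) * (Uᵀ * U) *
            (diagonal hH.eigenvalues * Uᵀ) := by simp only [Matrix.mul_assoc]
        _ = _ := by rw [hU]; simp only [Matrix.mul_assoc, Matrix.mul_one, Matrix.one_mul]

lemma trace_dkek (K : Matrix d d ℝ) (l m : d → ℝ) :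
    trace (diagonal l * K * diagonal m * Kᵀ) = ∑ a, ∑ b, K a b ^ 2 * (l a * m b) := by
  simp only [trace, diag_apply]
  refine Finset.sum_congr rfl fun a _ => ?_
  rw [Matrix.mul_apply]
  refine Finset.sum_congr rfl fun b _ => ?_
  rw [Matrix.mul_diagonal, Matrix.diagonal_mul, transpose_apply]; ring

lemma trace_ineq (H X Y : Matrix d d ℝ) (hH : Hᵀ = H) (hX : Xᵀ = X) (hY : Yᵀ = Y)
    (s : ℕ) (hs : Even s) :
    ∑ q ∈ range (s + 1), trace (H * X ^ q * H * Y ^ (s - q)) ≤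
      ((s : ℝ) + 1) / 2 * (trace (H * H * X ^ s) + trace (H * H * Y ^ s)) := by
  obtain ⟨U, l, hU1, hU2, hUq⟩ := spectral X hX
  obtain ⟨V, m, hV1, hV2, hVq⟩ := spectral Y hY
  set K := Uᵀ * H * V with hK
  have hKt : Kᵀ = Vᵀ * H * U := by
    rw [hK, transpose_mul, transpose_mul, transpose_transpose, hH, Matrix.mul_assoc]
  have e1 : ∀ q r : ℕ, trace (H * X ^ q * H * Y ^ r) = ∑ a, ∑ b, K a b ^ 2 * (l a ^ q * m b ^ r) := by
    intro q r
    rw [← trace_dkek K (fun a => l a ^ q) (fun b => m b ^ r), hKt, hUq, hVq, hK]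
    rw [Matrix.trace_mul_comm (diagonal _ * _ * _)]
    rw [show H * (U * (diagonal fun a => l a ^ q) * Uᵀ) * H * (V * (diagonal fun a => m a ^ r) * Vᵀ)
      = (H * U * (diagonal fun a => l a ^ q) * Uᵀ * H * V * (diagonal fun a => m a ^ r)) * Vᵀ by
        simp only [Matrix.mul_assoc]]
    rw [Matrix.trace_mul_comm]
    simp only [Matrix.mul_assoc]
  have e2 : trace (H * H * X ^ s) = ∑ a, ∑ b, K a b ^ 2 * (l a ^ s) := by
    have := e1 s 0
    simp only [pow_zero, mul_one] at this
    rw [← this, Matrix.trace_mul_comm (H * X ^ s) H, ← Matrix.mul_assoc]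
  have e3 : trace (H * H * Y ^ s) = ∑ a, ∑ b, K a b ^ 2 * (m b ^ s) := by
    have := e1 0 s
    simp only [pow_zero, one_mul, mul_one] at this
    rw [← this]
  rw [e2, e3, ← Finset.sum_add_distrib]
  simp only [e1]
  rw [Finset.sum_comm, Finset.mul_sum]
  refine Finset.sum_le_sum fun a _ => ?_
  rw [Finset.sum_comm, ← Finset.sum_add_distrib, Finset.mul_sum]
  refine Finset.sum_le_sum fun b _ => ?_
  have := mul_le_mul_of_nonneg_left (sum_pow_le (l a) (m b) s hs) (sq_nonneg (K a b))
  rw [Finset.mul_sum] at this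
  refine this.trans (le_of_eq ?_)
  ring

lemma telescope (X Y D : Matrix d d ℝ) (h : X - Y = D) (s : ℕ) :
    X ^ (s + 1) - Y ^ (s + 1) = ∑ q ∈ range (s + 1), X ^ q * D * Y ^ (s - q) := by
  induction s with
  | zero => simp [h]
  | succ s ih =>
    rw [Finset.sum_range_succ]
    have : ∑ q ∈ range (s + 1), X ^ q * D * Y ^ (s + 1 - q)
        = (∑ q ∈ range (s + 1), X ^ q * D * Y ^ (s - q)) * Y := by
      rw [Finset.sum_mul]
      refine Finset.sum_congr rfl fun q hq => ?_
      have : q ≤ s := by simpa [Nat.lt_succ_iff] using hq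
      rw [show s + 1 - q = (s - q) + 1 by omega, pow_succ, ← Matrix.mul_assoc]
    rw [this, ← ih, ← h]
    simp only [Nat.sub_self, pow_zero, mul_one]
    rw [pow_succ X (s+1), pow_succ Y (s+1)]
    noncomm_ring

lemma trace_sq_form (G : Matrix d d ℝ) (Z : Matrix d d ℝ) (hZ : Zᵀ = Z) (hG : Gᵀ = G) :
    trace (G * G * (Z * Z)) = ∑ c, nsq (G *ᵥ (Z.col c)) := by
  have : trace (G * G * (Z * Z)) = trace ((G * Z)ᵀ * (G * Z)) := by
    rw [transpose_mul, hZ, hG, ← Matrix.mul_assoc, Matrix.trace_mul_comm]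
    simp only [Matrix.mul_assoc]
  rw [this]
  simp only [trace, diag_apply]
  refine Finset.sum_congr rfl fun c _ => ?_
  rw [Matrix.mul_apply]
  simp only [nsq, dotProduct, transpose_apply]
  rfl

lemma trace_sq_form' (Z : Matrix d d ℝ) (hZ : Zᵀ = Z) :
    trace (Z * Z) = ∑ c, nsq (Z.col c) := by
  have := trace_sq_form (1 : Matrix d d ℝ) Z hZ (by simp)
  simpa using this

lemma pow_two_mul_sym (X : Matrix d d ℝ) (p : ℕ) : X ^ (2 * p) = X ^ p * X ^ p := by
  rw [two_mul, pow_add]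

lemma trace_even_nonneg (X : Matrix d d ℝ) (hX : Xᵀ = X) (p : ℕ) : 0 ≤ trace (X ^ (2 * p)) := by
  rw [pow_two_mul_sym, trace_sq_form' _ (by rw [transpose_pow, hX])]
  exact Finset.sum_nonneg fun c _ => nsq_nonneg _

variable {Ωp ι : Type*} [Fintype Ωp]

/-- one step of the noncommutative Khintchine recursion -/
theorem nck_step [DecidableEq ι] (S : Finset ι) (x : ι → Ωp → ℝ) (f : ι → Equiv.Perm Ωp)
    (hx : ∀ i ∈ S, ∀ ω, x i (f i ω) = - x i ω)
    (hx' : ∀ i ∈ S, ∀ j ∈ S, i ≠ j → ∀ ω, x j (f i ω) = x j ω)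
    (hb : ∀ i ∈ S, ∀ ω, x i ω ^ 2 ≤ 1)
    (H : ι → Ωp → Matrix d d ℝ) (Hsym : ∀ i ω, (H i ω)ᵀ = H i ω)
    (Hinv : ∀ i ∈ S, ∀ j ∈ S, ∀ ω, H i (f j ω) = H i ω)
    (s : Ωp → ℝ) (φ : Ωp → ℝ) (φ0 : ∀ ω, 0 ≤ φ ω) (φinv : ∀ j ∈ S, ∀ ω, φ (f j ω) = φ ω)
    (hs : ∀ ω w, ∑ i ∈ S, nsq (H i ω *ᵥ w) ≤ s ω * nsq w) (p : ℕ) :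
    ∑ ω, φ ω * trace ((∑ i ∈ S, x i ω • H i ω) ^ (2 * (p + 1))) ≤
      (2 * p + 1) * ∑ ω, φ ω * s ω * trace ((∑ i ∈ S, x i ω • H i ω) ^ (2 * p)) := by
  set X : Ωp → Matrix d d ℝ := fun ω => ∑ i ∈ S, x i ω • H i ω with hXdef
  have Xsym : ∀ ω, (X ω)ᵀ = X ω := by
    intro ω
    simp only [hXdef, transpose_sum, transpose_smul, Hsym]
  have Xdiff : ∀ i ∈ S, ∀ ω, X ω - X (f i ω) = (2 * x i ω) • H i ω := by
    intro i hi ω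
    simp only [hXdef]
    rw [← Finset.sum_sub_distrib, Finset.sum_eq_single i]
    · rw [hx i hi, Hinv i hi i hi, ← sub_smul]; congr 1; ring
    · intro j hj hji
      rw [hx' i hi j hj (Ne.symm hji), Hinv j hj i hi, sub_self]
    · intro h; exact absurd hi h
  have expand : ∀ ω, trace (X ω ^ (2 * (p + 1)))
      = ∑ i ∈ S, x i ω * trace (H i ω * X ω ^ (2 * p + 1)) := by
    intro ω
    rw [show 2 * (p+1) = (2 * p + 1) + 1 by ring, pow_succ']
    conv_lhs => rw [hXdef]
    simp only [Finset.sum_mul, trace_sum, Matrix.smul_mul, trace_smul, smul_eq_mul]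
    rfl
  have half : ∀ i ∈ S, ∑ ω, φ ω * (x i ω * trace (H i ω * X ω ^ (2 * p + 1)))
      ≤ (2 * p + 1) * ∑ ω, φ ω * trace (H i ω * H i ω * X ω ^ (2 * p)) := by
    intro i hi
    have e1 : ∑ ω, φ ω * (x i ω * trace (H i ω * X ω ^ (2 * p + 1)))
        = - ∑ ω, φ ω * (x i ω * trace (H i ω * X (f i ω) ^ (2 * p + 1))) := by
      rw [← Equiv.sum_comp (f i), ← Finset.sum_neg_distrib]
      refine Finset.sum_congr rfl fun ω _ => ?_
      rw [φinv i hi, hx i hi, Hinv i hi i hi]; ring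
    have e2 : 2 * ∑ ω, φ ω * (x i ω * trace (H i ω * X ω ^ (2 * p + 1)))
        = ∑ ω, φ ω * (2 * x i ω ^ 2 *
          ∑ q ∈ range (2 * p + 1), trace (H i ω * X ω ^ q * H i ω * X (f i ω) ^ (2 * p - q))) := by
      rw [two_mul]
      nth_rewrite 2 [e1]
      rw [← sub_eq_add_neg, ← Finset.sum_sub_distrib]
      refine Finset.sum_congr rfl fun ω _ => ?_
      rw [← mul_sub, ← mul_sub, ← trace_sub, ← Matrix.mul_sub,
        telescope _ _ _ (Xdiff i hi ω), Finset.mul_sum, trace_sum, Finset.mul_sum, Finset.mul_sum, Finset.mul_sum, Finset.mul_sum]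
      refine Finset.sum_congr rfl fun q _ => ?_
      rw [Matrix.mul_smul, Matrix.smul_mul, Matrix.mul_smul, trace_smul, smul_eq_mul]
      simp only [Matrix.mul_assoc]
      ring
    have nn : ∀ ω ω', 0 ≤ trace (H i ω * H i ω * X ω' ^ (2 * p)) := by
      intro ω ω'
      rw [pow_two_mul_sym, trace_sq_form _ _ (by rw [transpose_pow, Xsym]) (Hsym i ω)]
      exact Finset.sum_nonneg fun c _ => nsq_nonneg _
    have e3 : 2 * ∑ ω, φ ω * (x i ω * trace (H i ω * X ω ^ (2 * p + 1)))
        ≤ ∑ ω, φ ω * ((2 * p + 1) * (trace (H i ω * H i ω * X ω ^ (2 * p))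
          + trace (H i ω * H i ω * X (f i ω) ^ (2 * p)))) := by
      rw [e2]
      refine Finset.sum_le_sum fun ω _ => mul_le_mul_of_nonneg_left ?_ (φ0 ω)
      have t := trace_ineq (H i ω) (X ω) (X (f i ω)) (Hsym i ω) (Xsym _) (Xsym _) (2 * p) (by simp)
      have n1 := nn ω ω
      have n2 := nn ω (f i ω)
      have hb1 := hb i hi ω
      push_cast at t
      set Q := ∑ q ∈ range (2 * p + 1), trace (H i ω * X ω ^ q * H i ω * X (f i ω) ^ (2 * p - q))
      set R := trace (H i ω * H i ω * X ω ^ (2 * p)) + trace (H i ω * H i ω * X (f i ω) ^ (2 * p))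
      have hR : 0 ≤ R := by positivity
      have hx2 := sq_nonneg (x i ω)
      have hR2 : 0 ≤ (2 * (p:ℝ) + 1) * R := by positivity
      nlinarith [mul_le_mul_of_nonneg_left t hx2, mul_le_mul_of_nonneg_right hb1 hR2]
    have e4 : ∑ ω, φ ω * trace (H i ω * H i ω * X (f i ω) ^ (2 * p))
        = ∑ ω, φ ω * trace (H i ω * H i ω * X ω ^ (2 * p)) := by
      rw [← Equiv.sum_comp (f i) (fun ω => φ ω * trace (H i ω * H i ω * X ω ^ (2 * p)))]
      refine Finset.sum_congr rfl fun ω _ => ?_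
      rw [φinv i hi, Hinv i hi i hi]
    have e5 : ∑ ω, φ ω * ((2 * p + 1) * (trace (H i ω * H i ω * X ω ^ (2 * p))
          + trace (H i ω * H i ω * X (f i ω) ^ (2 * p))))
        = 2 * ((2 * p + 1) * ∑ ω, φ ω * trace (H i ω * H i ω * X ω ^ (2 * p))) := by
      have : 2 * ((2 * p + 1) * ∑ ω, φ ω * trace (H i ω * H i ω * X ω ^ (2 * p)))
        = (2 * (p:ℝ) + 1) * (∑ ω, φ ω * trace (H i ω * H i ω * X ω ^ (2 * p))
          + ∑ ω, φ ω * trace (H i ω * H i ω * X (f i ω) ^ (2 * p))) := by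
        rw [e4]; ring
      rw [this, ← Finset.sum_add_distrib, Finset.mul_sum]
      refine Finset.sum_congr rfl fun ω _ => ?_
      ring
    rw [e5] at e3
    linarith
  have tot : ∑ ω, φ ω * trace (X ω ^ (2 * (p + 1)))
      = ∑ i ∈ S, ∑ ω, φ ω * (x i ω * trace (H i ω * X ω ^ (2 * p + 1))) := by
    rw [Finset.sum_comm]
    refine Finset.sum_congr rfl fun ω _ => ?_
    rw [expand, Finset.mul_sum]
  change ∑ ω, φ ω * trace (X ω ^ (2 * (p + 1))) ≤ (2 * p + 1) * ∑ ω, φ ω * s ω * trace (X ω ^ (2 * p))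
  rw [tot]
  refine (Finset.sum_le_sum half).trans ?_
  rw [← Finset.mul_sum]
  refine mul_le_mul_of_nonneg_left ?_ (by positivity)
  rw [Finset.sum_comm]
  refine Finset.sum_le_sum fun ω _ => ?_
  rw [← Finset.mul_sum, mul_assoc]
  refine mul_le_mul_of_nonneg_left ?_ (φ0 ω)
  have hXp : (X ω ^ p)ᵀ = X ω ^ p := by rw [transpose_pow, Xsym]
  rw [pow_two_mul_sym, trace_sq_form' _ hXp, Finset.mul_sum]
  simp only [trace_sq_form _ _ hXp (Hsym _ ω)]
  rw [Finset.sum_comm]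
  exact Finset.sum_le_sum fun c _ => hs ω _

theorem nck [DecidableEq ι] (S : Finset ι) (x : ι → Ωp → ℝ) (f : ι → Equiv.Perm Ωp)
    (hx : ∀ i ∈ S, ∀ ω, x i (f i ω) = - x i ω)
    (hx' : ∀ i ∈ S, ∀ j ∈ S, i ≠ j → ∀ ω, x j (f i ω) = x j ω)
    (hb : ∀ i ∈ S, ∀ ω, x i ω ^ 2 ≤ 1)
    (H : ι → Ωp → Matrix d d ℝ) (Hsym : ∀ i ω, (H i ω)ᵀ = H i ω)
    (Hinv : ∀ i ∈ S, ∀ j ∈ S, ∀ ω, H i (f j ω) = H i ω)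
    (s : Ωp → ℝ) (s0 : ∀ ω, 0 ≤ s ω) (sinv : ∀ j ∈ S, ∀ ω, s (f j ω) = s ω)
    (hs : ∀ ω w, ∑ i ∈ S, nsq (H i ω *ᵥ w) ≤ s ω * nsq w) (P p : ℕ) (hp : p ≤ P) (r : ℕ) :
    ∑ ω, s ω ^ r * trace ((∑ i ∈ S, x i ω • H i ω) ^ (2 * p)) ≤
      (2 * P : ℝ) ^ p * (Fintype.card d) * ∑ ω, s ω ^ (r + p) := by
  induction p generalizing r with
  | zero => 
    simp only [mul_zero, pow_zero, trace_one, one_mul, add_zero]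
    rw [← Finset.sum_mul, mul_comm]
  | succ p ih =>
    have h1 := nck_step S x f hx hx' hb H Hsym Hinv s (fun ω => s ω ^ r)
      (fun ω => pow_nonneg (s0 ω) _) (fun j hj ω => by simp only [sinv j hj]) hs p
    refine h1.trans ?_
    have h2 := ih (by omega) (r + 1)
    have h3 : ∑ ω, s ω ^ r * s ω * trace ((∑ i ∈ S, x i ω • H i ω) ^ (2 * p))
        = ∑ ω, s ω ^ (r + 1) * trace ((∑ i ∈ S, x i ω • H i ω) ^ (2 * p)) := by
      simp only [pow_succ]
    rw [h3]
    have hP : (2 * p + 1 : ℝ) ≤ 2 * P := by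
      have : 2 * p + 1 ≤ 2 * P := by omega
      exact_mod_cast this
    have nn : 0 ≤ (2 * P : ℝ) ^ p * (Fintype.card d) * ∑ ω, s ω ^ (r + 1 + p) := by
      have : 0 ≤ ∑ ω, s ω ^ (r + 1 + p) := Finset.sum_nonneg fun ω _ => pow_nonneg (s0 ω) _
      positivity
    calc _ ≤ (2 * p + 1 : ℝ) * ((2 * P : ℝ) ^ p * (Fintype.card d) * ∑ ω, s ω ^ (r + 1 + p)) :=
          mul_le_mul_of_nonneg_left h2 (by positivity)
      _ ≤ (2 * P : ℝ) * ((2 * P : ℝ) ^ p * (Fintype.card d) * ∑ ω, s ω ^ (r + 1 + p)) :=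
          mul_le_mul_of_nonneg_right hP nn
      _ = _ := by rw [show r + 1 + p = r + (p + 1) by ring]; ring

end KB

namespace KB
open Finset Matrix
open scoped Matrix.Norms.L2Operator

section
variable {d e : Type*} [Fintype d] [DecidableEq d] [Fintype e] [DecidableEq e]

lemma nsq_eq_norm (w : d → ℝ) : nsq w = ‖(WithLp.toLp 2 w : EuclideanSpace ℝ d)‖ ^ 2 := by
  rw [EuclideanSpace.norm_sq_eq]
  simp [nsq, dotProduct, sq]

lemma nsq_mulVec_le (M : Matrix d d ℝ) (w : d → ℝ) : nsq (M *ᵥ w) ≤ ‖M‖ ^ 2 * nsq w := by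
  rw [nsq_eq_norm, nsq_eq_norm, ← mul_pow]
  have := l2_opNorm_mulVec M (WithLp.toLp 2 w)
  exact pow_le_pow_left₀ (norm_nonneg _) this 2

lemma norm_le_of_nsq (M : Matrix d d ℝ) (c : ℝ) (hc : 0 ≤ c)
    (h : ∀ w, nsq (M *ᵥ w) ≤ c ^ 2 * nsq w) : ‖M‖ ≤ c := by
  rw [l2_opNorm_def]
  refine ContinuousLinearMap.opNorm_le_bound _ hc fun x => ?_
  have := h x.ofLp
  rw [nsq_eq_norm, nsq_eq_norm, ← mul_pow] at this
  exact le_of_sq_le_sq this (by positivity)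

lemma norm_transpose' (M : Matrix d d ℝ) : ‖Mᵀ‖ = ‖M‖ := by
  rw [← l2_opNorm_conjTranspose M, conjTranspose_eq_transpose_of_trivial]

lemma dot_le_half (u v : d → ℝ) : u ⬝ᵥ v ≤ (nsq u + nsq v) / 2 := by
  unfold nsq dotProduct
  rw [← Finset.sum_add_distrib, Finset.sum_div]
  refine Finset.sum_le_sum fun i _ => ?_
  nlinarith [sq_nonneg (u i - v i)]

lemma nsq_smul (c : ℝ) (v : d → ℝ) : nsq (c • v) = c ^ 2 * nsq v := by
  simp [nsq, smul_dotProduct, dotProduct_smul]; ring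

lemma nsq_zero_iff (v : d → ℝ) : nsq v = 0 ↔ v = 0 := dotProduct_self_eq_zero

lemma dot_sq_le (u v : d → ℝ) : (u ⬝ᵥ v) ^ 2 ≤ nsq u * nsq v := by
  unfold nsq dotProduct
  have := Finset.sum_mul_sq_le_sq_mul_sq univ u v
  simpa [sq] using this

lemma dot_le (M : Matrix d d ℝ) (w : d → ℝ) : w ⬝ᵥ (M *ᵥ w) ≤ ‖M‖ * nsq w := by
  have h1 := dot_sq_le w (M *ᵥ w)
  have h2 := nsq_mulVec_le M w
  have h3 := nsq_nonneg w
  refine le_of_sq_le_sq ?_ (by positivity)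
  nlinarith

/-- bound a norm from a bound on the bilinear form -/
lemma norm_le_of_bilin (M : Matrix d d ℝ) (c : ℝ) (hc : 0 ≤ c)
    (h : ∀ u v, nsq u ≤ 1 → nsq v ≤ 1 → u ⬝ᵥ (M *ᵥ v) ≤ c) : ‖M‖ ≤ c := by
  refine norm_le_of_nsq M c hc fun w => ?_
  by_cases hw : nsq w = 0
  · have : w = 0 := (nsq_zero_iff w).1 hw
    subst this
    simp [nsq]
  have hw0 : 0 < nsq w := lt_of_le_of_ne (nsq_nonneg w) (Ne.symm hw)
  by_cases hm : nsq (M *ᵥ w) = 0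
  · rw [hm]; positivity
  have hm0 : 0 < nsq (M *ᵥ w) := lt_of_le_of_ne (nsq_nonneg _) (Ne.symm hm)
  set a := Real.sqrt (nsq w)
  set b := Real.sqrt (nsq (M *ᵥ w))
  have ha : a ^ 2 = nsq w := Real.sq_sqrt hw0.le
  have hb : b ^ 2 = nsq (M *ᵥ w) := Real.sq_sqrt hm0.le
  have ha0 : 0 < a := Real.sqrt_pos.2 hw0
  have hb0 : 0 < b := Real.sqrt_pos.2 hm0
  have := h (b⁻¹ • (M *ᵥ w)) (a⁻¹ • w) (by
      rw [nsq_smul, ← hb]; field_simp; exact le_refl _) (by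
      rw [nsq_smul, ← ha]; field_simp; exact le_refl _)
  rw [mulVec_smul, smul_dotProduct, dotProduct_smul] at this
  change b⁻¹ • (a⁻¹ • nsq (M *ᵥ w)) ≤ c at this
  rw [← hb] at this
  simp only [smul_eq_mul] at this
  have h2 : b⁻¹ * (a⁻¹ * b ^ 2) = b / a := by field_simp
  rw [h2, div_le_iff₀ ha0] at this
  rw [← hb, ← ha, ← mul_pow]
  exact pow_le_pow_left₀ hb0.le this 2

lemma dot_transpose_mul (Y Z : Matrix d d ℝ) (u v : d → ℝ) :
    u ⬝ᵥ ((Yᵀ * Z) *ᵥ v) = (Y *ᵥ u) ⬝ᵥ (Z *ᵥ v) := by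
  rw [← mulVec_mulVec, dotProduct_mulVec, vecMul_transpose]

lemma sum_nsq_eq {ι : Type*} (S : Finset ι) (Y : ι → Matrix d d ℝ) (w : d → ℝ) :
    ∑ i ∈ S, nsq (Y i *ᵥ w) = w ⬝ᵥ ((∑ i ∈ S, (Y i)ᵀ * Y i) *ᵥ w) := by
  rw [Matrix.sum_mulVec, dotProduct_sum]
  refine Finset.sum_congr rfl fun i _ => ?_
  rw [dot_transpose_mul]; rfl

lemma sum_nsq_le {ι : Type*} (S : Finset ι) (Y : ι → Matrix d d ℝ) (w : d → ℝ) :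
    ∑ i ∈ S, nsq (Y i *ᵥ w) ≤ ‖∑ i ∈ S, (Y i)ᵀ * Y i‖ * nsq w := by
  rw [sum_nsq_eq]; exact dot_le _ _

lemma gram_norm_le {ι : Type*} (S : Finset ι) (Y : ι → Matrix d d ℝ) (c : ℝ) (hc : 0 ≤ c)
    (h : ∀ w, ∑ i ∈ S, nsq (Y i *ᵥ w) ≤ c * nsq w) : ‖∑ i ∈ S, (Y i)ᵀ * Y i‖ ≤ c := by
  refine norm_le_of_bilin _ c hc fun u v hu hv => ?_
  rw [Matrix.sum_mulVec, dotProduct_sum]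
  have h1 : ∑ i ∈ S, u ⬝ᵥ (((Y i)ᵀ * Y i) *ᵥ v)
      ≤ ∑ i ∈ S, (nsq (Y i *ᵥ u) + nsq (Y i *ᵥ v)) / 2 := by
    refine Finset.sum_le_sum fun i _ => ?_
    rw [dot_transpose_mul]; exact dot_le_half _ _
  refine h1.trans ?_
  rw [← Finset.sum_div, Finset.sum_add_distrib]
  have := h u
  have := h v
  nlinarith

lemma norm_pow_le_trace (X : Matrix d d ℝ) (hX : Xᵀ = X) (p : ℕ) (hp : 1 ≤ p) :
    ‖X‖ ^ (2 * p) ≤ trace (X ^ (2 * p)) := by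
  obtain ⟨U, l, hU1, hU2, hUq⟩ := spectral X hX
  have htr : ∀ q, trace (X ^ q) = ∑ a, l a ^ q := by
    intro q
    rw [hUq, Matrix.trace_mul_comm, ← Matrix.mul_assoc, hU2, Matrix.one_mul, trace_diagonal]
  rcases isEmpty_or_nonempty d with hd | hd
  · have : ‖X‖ ≤ 0 := norm_le_of_nsq X 0 le_rfl fun w => by
      simp [nsq, dotProduct]
    have h0 : ‖X‖ = 0 := le_antisymm this (norm_nonneg _)
    rw [h0, zero_pow (by omega)]
    exact trace_even_nonneg X hX p
  obtain ⟨a, -, ha⟩ := Finset.exists_max_image univ (fun a => |l a|) Finset.univ_nonempty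
  have hn : ‖X‖ ≤ |l a| := by
    refine norm_le_of_nsq X _ (abs_nonneg _) fun w => ?_
    have h1 : nsq (X *ᵥ w) = w ⬝ᵥ (X ^ 2 *ᵥ w) := by
      have := dot_transpose_mul X X w w
      rw [hX, ← sq] at this
      exact this.symm
    have h2 : w ⬝ᵥ (X ^ 2 *ᵥ w) = ∑ b, l b ^ 2 * (Uᵀ *ᵥ w) b ^ 2 := by
      rw [hUq, Matrix.mul_assoc]
      have := dot_transpose_mul Uᵀ (diagonal (fun a => l a ^ 2) * Uᵀ) w w
      rw [transpose_transpose] at this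
      rw [this, ← mulVec_mulVec]
      simp only [dotProduct, mulVec_diagonal]
      refine Finset.sum_congr rfl fun b _ => ?_
      ring
    have h3 : nsq w = ∑ b, (Uᵀ *ᵥ w) b ^ 2 := by
      have := dot_transpose_mul Uᵀ Uᵀ w w
      rw [transpose_transpose, hU1, one_mulVec] at this
      rw [nsq, this]
      simp only [dotProduct, sq]
    rw [h1, h2, h3, Finset.mul_sum]
    refine Finset.sum_le_sum fun b _ => mul_le_mul_of_nonneg_right ?_ (sq_nonneg _)
    rw [sq_abs]
    exact sq_le_sq.2 (ha b (mem_univ _))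
  rw [htr]
  calc ‖X‖ ^ (2 * p) ≤ |l a| ^ (2 * p) := pow_le_pow_left₀ (norm_nonneg _) hn _
    _ = l a ^ (2 * p) := by rw [Even.pow_abs]; simp
    _ ≤ _ := Finset.single_le_sum (f := fun a => l a ^ (2 * p))
      (fun b _ => by rw [pow_mul]; positivity) (mem_univ a)

/-- Hermitian dilation -/
def dil (N : Matrix d d ℝ) : Matrix (d ⊕ d) (d ⊕ d) ℝ := fromBlocks 0 N Nᵀ 0

lemma dil_sym (N : Matrix d d ℝ) : (dil N)ᵀ = dil N := by
  simp [dil, fromBlocks_transpose]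

lemma nsq_sum_type (w : d ⊕ d → ℝ) : nsq w = nsq (w ∘ Sum.inl) + nsq (w ∘ Sum.inr) := by
  simp [nsq, dotProduct, Fintype.sum_sum_type]

lemma nsq_dil (N : Matrix d d ℝ) (w : d ⊕ d → ℝ) :
    nsq (dil N *ᵥ w) = nsq (N *ᵥ (w ∘ Sum.inr)) + nsq (Nᵀ *ᵥ (w ∘ Sum.inl)) := by
  rw [nsq_sum_type, dil, fromBlocks_mulVec]
  simp [Function.comp_def]

lemma norm_le_dil (N : Matrix d d ℝ) : ‖N‖ ≤ ‖dil N‖ := by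
  refine norm_le_of_nsq N _ (norm_nonneg _) fun w => ?_
  have := nsq_mulVec_le (dil N) (Sum.elim 0 w)
  rw [nsq_dil, nsq_sum_type] at this
  simp only [Sum.elim_comp_inr, Sum.elim_comp_inl] at this
  have z : nsq (0 : d → ℝ) = 0 := by simp [nsq]
  rw [z, zero_add] at this
  have := nsq_nonneg (Nᵀ *ᵥ (0 : d → ℝ))
  linarith

lemma dil_sum {ι : Type*} (S : Finset ι) (x : ι → ℝ) (N : ι → Matrix d d ℝ) :
    dil (∑ i ∈ S, x i • N i) = ∑ i ∈ S, x i • dil (N i) := by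
  ext a b
  rcases a with a | a <;> rcases b with b | b <;>
    simp [dil, Matrix.sum_apply, fromBlocks]

theorem nck_norm {Ωp ι : Type*} [Fintype Ωp] [DecidableEq ι]
    (S : Finset ι) (x : ι → Ωp → ℝ) (f : ι → Equiv.Perm Ωp)
    (hx : ∀ i ∈ S, ∀ ω, x i (f i ω) = - x i ω)
    (hx' : ∀ i ∈ S, ∀ j ∈ S, i ≠ j → ∀ ω, x j (f i ω) = x j ω)
    (hb : ∀ i ∈ S, ∀ ω, x i ω ^ 2 ≤ 1)
    (N : ι → Ωp → Matrix d d ℝ)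
    (Ninv : ∀ i ∈ S, ∀ j ∈ S, ∀ ω, N i (f j ω) = N i ω)
    (s : Ωp → ℝ) (s0 : ∀ ω, 0 ≤ s ω) (sinv : ∀ j ∈ S, ∀ ω, s (f j ω) = s ω)
    (hs1 : ∀ ω w, ∑ i ∈ S, nsq (N i ω *ᵥ w) ≤ s ω * nsq w)
    (hs2 : ∀ ω w, ∑ i ∈ S, nsq ((N i ω)ᵀ *ᵥ w) ≤ s ω * nsq w) (p : ℕ) (hp : 1 ≤ p) :
    ∑ ω, ‖∑ i ∈ S, x i ω • N i ω‖ ^ (2 * p) ≤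
      2 * Fintype.card d * (2 * p : ℝ) ^ p * ∑ ω, s ω ^ p := by
  have h := nck S x f hx hx' hb (fun i ω => dil (N i ω)) (fun i ω => dil_sym _)
    (fun i hi j hj ω => by simp only [Ninv i hi j hj]) s s0 sinv (fun ω w => by
      simp only [nsq_dil]
      rw [Finset.sum_add_distrib, nsq_sum_type]
      have a := hs1 ω (w ∘ Sum.inr)
      have b := hs2 ω (w ∘ Sum.inl)
      nlinarith) p p le_rfl 0
  simp only [pow_zero, one_mul, zero_add, Fintype.card_sum] at h
  push_cast at h
  refine le_trans (Finset.sum_le_sum fun ω _ => ?_) (h.trans (le_of_eq (by ring)))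
  calc _ ≤ ‖dil (∑ i ∈ S, x i ω • N i ω)‖ ^ (2 * p) :=
        pow_le_pow_left₀ (norm_nonneg _) (norm_le_dil _) _
    _ ≤ trace ((dil (∑ i ∈ S, x i ω • N i ω)) ^ (2 * p)) :=
        norm_pow_le_trace _ (dil_sym _) p hp
    _ = _ := by rw [dil_sum]
end
end KB

namespace KB
open Finset Matrix
open scoped Matrix.Norms.L2Operator

/-- flip one Boolean coordinate -/
def flipAt {ι : Type*} [DecidableEq ι] (i : ι) : Equiv.Perm (ι → Bool) where
  toFun η := Function.update η i (!η i)
  invFun η := Function.update η i (!η i)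
  left_inv η := by simp
  right_inv η := by simp

lemma flipAt_same {ι : Type*} [DecidableEq ι] (i : ι) (η : ι → Bool) : flipAt i η i = !η i := by
  simp [flipAt]

lemma flipAt_ne {ι : Type*} [DecidableEq ι] (i j : ι) (h : j ≠ i) (η : ι → Bool) :
    flipAt i η j = η j := by
  simp [flipAt, h]

/-- a family of finitely many sign-like variables with flips -/
structure Signs (Ωp ι : Type*) where
  x : ι → Ωp → ℝ
  f : ι → Equiv.Perm Ωp
  hx : ∀ i ω, x i (f i ω) = - x i ω
  hx' : ∀ i j, i ≠ j → ∀ ω, x j (f i ω) = x j ω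
  hb : ∀ i ω, |x i ω| ≤ 1

/-- indicator of a Boolean -/
def bi (b : Bool) : ℝ := if b then 1 else 0

lemma bi_not (b : Bool) : bi (!b) = 1 - bi b := by cases b <;> simp [bi]
lemma bi_nonneg (b : Bool) : 0 ≤ bi b := by cases b <;> simp [bi]
lemma bi_le (b : Bool) : bi b ≤ 1 := by cases b <;> simp [bi]

lemma sum_bi {σ : Type*} [Fintype σ] [DecidableEq σ] (s t : σ) :
    ∑ η : σ → Bool, bi (η s) * bi (!η t)
      = if s = t then 0 else (Fintype.card (σ → Bool) : ℝ) / 4 := by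
  split_ifs with h
  · subst h
    refine Finset.sum_eq_zero fun η _ => ?_
    cases η s <;> simp [bi]
  · have h1 : ∑ η : σ → Bool, bi (η s) * bi (!η t) = ∑ η : σ → Bool, bi (!η s) * bi (!η t) := by
      rw [← Equiv.sum_comp (flipAt s)]
      refine Finset.sum_congr rfl fun η _ => ?_
      rw [flipAt_same, flipAt_ne _ _ (Ne.symm h)]
    have h2 : ∑ η : σ → Bool, bi (!η t) = ∑ η : σ → Bool, bi (η t) := by
      rw [← Equiv.sum_comp (flipAt t)]
      refine Finset.sum_congr rfl fun η _ => ?_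
      rw [flipAt_same, Bool.not_not]
    have h3 : ∑ η : σ → Bool, bi (η s) * bi (!η t) + ∑ η : σ → Bool, bi (!η s) * bi (!η t)
        = ∑ η : σ → Bool, bi (!η t) := by
      rw [← Finset.sum_add_distrib]
      refine Finset.sum_congr rfl fun η _ => ?_
      rw [bi_not (η s)]; ring
    have h4 : ∑ η : σ → Bool, bi (!η t) + ∑ η : σ → Bool, bi (η t)
        = (Fintype.card (σ → Bool) : ℝ) := by
      rw [← Finset.sum_add_distrib]
      simp [bi_not]
    linarith

section
variable {d : Type*} [Fintype d] [DecidableEq d]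
variable {Ωp L A σ : Type*} [Fintype Ωp] [Fintype L] [DecidableEq L] [Fintype A] [DecidableEq A]
  [Fintype σ] [DecidableEq σ]

/-- both Gram sums are bounded by `κ` -/
def KB2 (K : A → Matrix d d ℝ) (κ : ℝ) : Prop :=
  (∀ w, ∑ a, nsq (K a *ᵥ w) ≤ κ * nsq w) ∧ (∀ w, ∑ a, nsq ((K a)ᵀ *ᵥ w) ≤ κ * nsq w)

/-- masked random matrix -/
def Ymat (X : Signs Ωp (L × A)) (lab : A → σ) (K : A → Matrix d d ℝ) (δ : σ → Bool) (l : L)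
    (ω : Ωp) : Matrix d d ℝ := ∑ a, (bi (δ (lab a)) * X.x (l, a) ω) • K a

lemma Ymat_transpose (X : Signs Ωp (L × A)) (lab : A → σ) (K : A → Matrix d d ℝ) (δ : σ → Bool)
    (l : L) (ω : Ωp) : (Ymat X lab K δ l ω)ᵀ = Ymat X lab (fun a => (K a)ᵀ) δ l ω := by
  simp [Ymat, transpose_sum]

lemma Ymat_inv (X : Signs Ωp (L × A)) (lab : A → σ) (K : A → Matrix d d ℝ) (β : σ → Bool) (l : L)
    (ω : Ωp) (j : L × A) (hj : β (lab j.2) = false) :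
    Ymat X lab K β l (X.f j ω) = Ymat X lab K β l ω := by
  unfold Ymat
  refine Finset.sum_congr rfl fun a _ => ?_
  by_cases h : (l, a) = j
  · subst h
    simp only at hj
    simp [hj, bi]
  · rw [X.hx' j (l, a) (Ne.symm h)]

lemma cross (X : Signs Ωp (L × A)) (lab : A → σ) (K : A → Matrix d d ℝ) (κ : ℝ) (hκ0 : 0 ≤ κ)
    (hK : KB2 K κ) (α : σ → Bool)
    (Z : L → Ωp → Matrix d d ℝ) (hZ : ∀ l ω, ∀ j : L × A, α (lab j.2) = true → Z l (X.f j ω) = Z l ω)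
    (g : Ωp → ℝ) (g0 : ∀ ω, 0 ≤ g ω) (hg : ∀ ω, ∀ j : L × A, α (lab j.2) = true → g (X.f j ω) = g ω)
    (h1 : ∀ ω w, ∑ l, nsq (Z l ω *ᵥ w) ≤ g ω * nsq w)
    (h2 : ∀ ω w, ∑ l, nsq ((Z l ω)ᵀ *ᵥ w) ≤ g ω * nsq w) (p : ℕ) (hp : 1 ≤ p) :
    ∑ ω, ‖∑ l, Ymat X lab K α l ω * Z l ω‖ ^ (2 * p)
      ≤ 2 * Fintype.card d * (2 * p : ℝ) ^ p * ∑ ω, (κ * g ω) ^ p := by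
  set S : Finset (L × A) := univ.filter fun j => α (lab j.2) = true with hS
  have memS : ∀ j, j ∈ S ↔ α (lab j.2) = true := by intro j; simp [hS]
  have hsub : ∀ F : L × A → ℝ, (∀ j, 0 ≤ F j) → ∑ j ∈ S, F j ≤ ∑ l, ∑ a, F (l, a) := by
    intro F hF
    rw [← Fintype.sum_prod_type]
    exact Finset.sum_le_sum_of_subset_of_nonneg (subset_univ _) fun j _ _ => hF j
  have key := nck_norm S X.x X.f (fun i _ ω => X.hx i ω) (fun i _ j _ h ω => X.hx' i j h ω)
    (fun i _ ω => by
      have := X.hb i ω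
      rw [← sq_abs]; nlinarith [abs_nonneg (X.x i ω)])
    (fun j ω => K j.2 * Z j.1 ω)
    (fun i _ j hj ω => by simp only [hZ i.1 ω j ((memS j).1 hj)])
    (fun ω => κ * g ω) (fun ω => mul_nonneg hκ0 (g0 ω))
    (fun j hj ω => by simp only [hg ω j ((memS j).1 hj)])
    (fun ω w => by
      refine (hsub _ fun j => nsq_nonneg _).trans ?_
      calc ∑ l, ∑ a, nsq ((K a * Z l ω) *ᵥ w) ≤ ∑ l, κ * nsq (Z l ω *ᵥ w) := by
            refine Finset.sum_le_sum fun l _ => ?_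
            simp only [← mulVec_mulVec]
            exact hK.1 _
        _ ≤ κ * (g ω * nsq w) := by
            rw [← Finset.mul_sum]
            exact mul_le_mul_of_nonneg_left (h1 ω w) hκ0
        _ = _ := by ring)
    (fun ω w => by
      refine (hsub _ fun j => nsq_nonneg _).trans ?_
      rw [Finset.sum_comm]
      calc ∑ a, ∑ l, nsq ((K a * Z l ω)ᵀ *ᵥ w) ≤ ∑ a, g ω * nsq ((K a)ᵀ *ᵥ w) := by
            refine Finset.sum_le_sum fun a _ => ?_
            simp only [transpose_mul, ← mulVec_mulVec]
            exact h2 ω _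
        _ ≤ g ω * (κ * nsq w) := by
            rw [← Finset.mul_sum]
            exact mul_le_mul_of_nonneg_left (hK.2 w) (g0 ω)
        _ = _ := by ring) p hp
  refine le_trans (le_of_eq ?_) key
  refine Finset.sum_congr rfl fun ω _ => ?_
  congr 2
  rw [hS, Finset.sum_filter, Fintype.sum_prod_type]
  refine Finset.sum_congr rfl fun l _ => ?_
  unfold Ymat
  rw [Finset.sum_mul]
  refine Finset.sum_congr rfl fun a _ => ?_
  rw [Matrix.smul_mul]
  by_cases h : α (lab a) = true <;> simp [h, bi]

/-- off-diagonal chaos -/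
def offC (X : Signs Ωp (L × A)) (lab : A → σ) (K' K : A → Matrix d d ℝ) (δ : σ → Bool)
    (ω : Ωp) : Matrix d d ℝ :=
  ∑ l : L, ∑ a, ∑ b, (if lab a = lab b then 0 else
    (bi (δ (lab a)) * X.x (l, a) ω) * (bi (δ (lab b)) * X.x (l, b) ω)) • (K' a * K b)

/-- diagonal chaos -/
def diagC (X : Signs Ωp (L × A)) (lab : A → σ) (K' K : A → Matrix d d ℝ) (δ : σ → Bool)
    (ω : Ωp) : Matrix d d ℝ :=
  ∑ l : L, ∑ a, ∑ b, (if lab a = lab b then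
    (bi (δ (lab a)) * X.x (l, a) ω) * (bi (δ (lab b)) * X.x (l, b) ω) else 0) • (K' a * K b)

lemma split_chaos (X : Signs Ωp (L × A)) (lab : A → σ) (K' K : A → Matrix d d ℝ) (δ : σ → Bool)
    (ω : Ωp) : ∑ l : L, Ymat X lab K' δ l ω * Ymat X lab K δ l ω
      = diagC X lab K' K δ ω + offC X lab K' K δ ω := by
  unfold diagC offC Ymat
  simp only [← Finset.sum_add_distrib, ← add_smul, Finset.sum_mul_sum, Matrix.smul_mul,
    Matrix.mul_smul, smul_smul]
  refine Finset.sum_congr rfl fun l _ => Finset.sum_congr rfl fun a _ =>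
    Finset.sum_congr rfl fun b _ => ?_
  congr 1
  split_ifs <;> ring

lemma decouple (X : Signs Ωp (L × A)) (lab : A → σ) (K' K : A → Matrix d d ℝ) (δ : σ → Bool)
    (ω : Ωp) : offC X lab K' K δ ω = ∑ η : σ → Bool, ((Fintype.card (σ → Bool) : ℝ)⁻¹) •
      ((4 : ℝ) • ∑ l : L, Ymat X lab K' (fun s => δ s && η s) l ω *
        Ymat X lab K (fun s => δ s && !η s) l ω) := by
  have hc : (Fintype.card (σ → Bool) : ℝ) ≠ 0 := by
    have : 0 < Fintype.card (σ → Bool) := Fintype.card_pos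
    positivity
  have hb : ∀ b c : Bool, bi (b && c) = bi b * bi c := by
    intro b c; cases b <;> cases c <;> simp [bi]
  simp only [Finset.smul_sum, Ymat, Finset.sum_mul_sum, Matrix.smul_mul, Matrix.mul_smul, smul_smul]
  rw [Finset.sum_comm]
  unfold offC
  refine Finset.sum_congr rfl fun l _ => ?_
  conv_rhs => rw [Finset.sum_comm]
  refine Finset.sum_congr rfl fun a _ => ?_
  conv_rhs => rw [Finset.sum_comm]
  refine Finset.sum_congr rfl fun b _ => ?_
  rw [← Finset.sum_smul]
  congr 1
  have : ∀ η : σ → Bool, (Fintype.card (σ → Bool) : ℝ)⁻¹ * (4 *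
      (bi (δ (lab a) && η (lab a)) * X.x (l, a) ω * (bi (δ (lab b) && !η (lab b)) * X.x (l, b) ω)))
      = ((Fintype.card (σ → Bool) : ℝ)⁻¹ * 4 *
      ((bi (δ (lab a)) * X.x (l, a) ω) * (bi (δ (lab b)) * X.x (l, b) ω))) *
        (bi (η (lab a)) * bi (!η (lab b))) := by
    intro η; rw [hb, hb]; ring
  have e : ∑ η : σ → Bool, (Fintype.card (σ → Bool) : ℝ)⁻¹ * (4 *
      (bi (δ (lab a) && η (lab a)) * X.x (l, a) ω * (bi (δ (lab b) && !η (lab b)) * X.x (l, b) ω)))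
      = (if lab a = lab b then 0 else
    (bi (δ (lab a)) * X.x (l, a) ω) * (bi (δ (lab b)) * X.x (l, b) ω)) := by
    simp only [this]
    rw [← Finset.mul_sum, sum_bi]
    split_ifs
    · simp
    · field_simp
  rw [← e]
  refine Finset.sum_congr rfl fun η _ => ?_
  ring

lemma diag_norm (X : Signs Ωp (L × A)) (lab : A → σ)
    (hlab : ∀ a, (univ.filter fun b => lab a = lab b).card ≤ 2)
    (K' K : A → Matrix d d ℝ) (κ : ℝ) (hκ0 : 0 ≤ κ) (hK' : KB2 K' κ) (hK : KB2 K κ) (δ : σ → Bool)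
    (ω : Ωp) : ‖diagC X lab K' K δ ω‖ ≤ 2 * Fintype.card L * κ := by
  refine norm_le_of_bilin _ _ (by positivity) fun u v hu hv => ?_
  unfold diagC
  simp only [Matrix.sum_mulVec, dotProduct_sum, smul_mulVec, dotProduct_smul, smul_eq_mul]
  have yb : ∀ l a, |bi (δ (lab a)) * X.x (l, a) ω| ≤ 1 := by
    intro l a
    rw [abs_mul, abs_of_nonneg (bi_nonneg _)]
    exact mul_le_one₀ (bi_le _) (abs_nonneg _) (X.hb _ _)
  have main : ∀ l : L, ∑ a, ∑ b, (if lab a = lab b then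
      (bi (δ (lab a)) * X.x (l, a) ω) * (bi (δ (lab b)) * X.x (l, b) ω) else 0) *
        u ⬝ᵥ ((K' a * K b) *ᵥ v) ≤ 2 * κ := by
    intro l
    have h1 : ∀ a b, (if lab a = lab b then
      (bi (δ (lab a)) * X.x (l, a) ω) * (bi (δ (lab b)) * X.x (l, b) ω) else 0) *
        u ⬝ᵥ ((K' a * K b) *ᵥ v) ≤ (if lab a = lab b then nsq ((K' a)ᵀ *ᵥ u) / 2 else 0) +
          (if lab b = lab a then nsq (K b *ᵥ v) / 2 else 0) := by
      intro a b
      by_cases h : lab a = lab b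
      · rw [if_pos h, if_pos h, if_pos h.symm]
        set c := (bi (δ (lab a)) * X.x (l, a) ω) * (bi (δ (lab b)) * X.x (l, b) ω)
        have hc : c ^ 2 ≤ 1 := by
          rw [sq_le_one_iff_abs_le_one, abs_mul]
          exact mul_le_one₀ (yb l a) (abs_nonneg _) (yb l b)
        have e := dot_transpose_mul (K' a)ᵀ (K b) u v
        rw [transpose_transpose] at e
        rw [e]
        have := dot_le_half (c • ((K' a)ᵀ *ᵥ u)) (K b *ᵥ v)
        rw [smul_dotProduct, nsq_smul, smul_eq_mul] at this
        have n1 := nsq_nonneg ((K' a)ᵀ *ᵥ u)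
        nlinarith
      · rw [if_neg h, if_neg h, if_neg (Ne.symm h)]; simp
    refine (Finset.sum_le_sum fun a _ => Finset.sum_le_sum fun b _ => h1 a b).trans ?_
    simp only [Finset.sum_add_distrib]
    have h2 : ∀ F : A → ℝ, (∀ a, 0 ≤ F a) →
        ∑ a, ∑ b, (if lab a = lab b then F a / 2 else 0) ≤ ∑ a, F a := by
      intro F hF
      refine Finset.sum_le_sum fun a _ => ?_
      rw [← Finset.sum_filter, Finset.sum_const, nsmul_eq_mul]
      have : ((univ.filter fun b => lab a = lab b).card : ℝ) ≤ 2 := by exact_mod_cast hlab a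
      nlinarith [hF a]
    have e1 := h2 (fun a => nsq ((K' a)ᵀ *ᵥ u)) (fun a => nsq_nonneg _)
    have e2 := h2 (fun a => nsq (K a *ᵥ v)) (fun a => nsq_nonneg _)
    rw [Finset.sum_comm] at e2
    have e3 := hK'.2 u
    have e4 := hK.1 v
    have : κ * nsq u ≤ κ := by nlinarith
    have : κ * nsq v ≤ κ := by nlinarith
    linarith
  refine (Finset.sum_le_sum fun l _ => main l).trans (le_of_eq ?_)
  rw [Finset.sum_const, nsmul_eq_mul, card_univ]; ring
end
end KB

set_option linter.unusedSectionVars false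
namespace KB
open Finset Matrix
open scoped Matrix.Norms.L2Operator
section
variable {d : Type*} [Fintype d] [DecidableEq d]
variable {Ωp L A σ : Type*} [Fintype Ωp] [Fintype L] [DecidableEq L] [Fintype A] [DecidableEq A]
  [Fintype σ] [DecidableEq σ]

lemma KB2.tr {K : A → Matrix d d ℝ} {κ : ℝ} (h : KB2 K κ) : KB2 (fun a => (K a)ᵀ) κ :=
  ⟨h.2, by simpa using h.1⟩

/-- random Gram norm -/
noncomputable def gf (X : Signs Ωp (L × A)) (lab : A → σ) (K : A → Matrix d d ℝ) (δ : σ → Bool) (ω : Ωp) : ℝ :=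
  ‖∑ l, (Ymat X lab K δ l ω)ᵀ * Ymat X lab K δ l ω‖ +
  ‖∑ l, Ymat X lab K δ l ω * (Ymat X lab K δ l ω)ᵀ‖

lemma gf_nonneg (X : Signs Ωp (L × A)) (lab : A → σ) (K : A → Matrix d d ℝ) (δ : σ → Bool)
    (ω : Ωp) : 0 ≤ gf X lab K δ ω := add_nonneg (norm_nonneg _) (norm_nonneg _)

/-- decoupled piece -/
def Vp (X : Signs Ωp (L × A)) (lab : A → σ) (K' K : A → Matrix d d ℝ) (δ η : σ → Bool)
    (ω : Ωp) : Matrix d d ℝ :=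
  ∑ l : L, Ymat X lab K' (fun s => δ s && η s) l ω * Ymat X lab K (fun s => δ s && !η s) l ω

lemma offC_norm (X : Signs Ωp (L × A)) (lab : A → σ) (K' K : A → Matrix d d ℝ) (δ : σ → Bool)
    (ω : Ωp) : ‖offC X lab K' K δ ω‖ ≤ ∑ η : σ → Bool, ((Fintype.card (σ → Bool) : ℝ)⁻¹) *
      (4 * ‖Vp X lab K' K δ η ω‖) := by
  rw [decouple]
  refine (norm_sum_le _ _).trans (Finset.sum_le_sum fun η _ => le_of_eq ?_)
  rw [norm_smul, norm_smul, Real.norm_of_nonneg (by positivity), Real.norm_of_nonneg (by norm_num)]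
  rfl

lemma Vp_mom (X : Signs Ωp (L × A)) (lab : A → σ) (K' K : A → Matrix d d ℝ) (κ' : ℝ)
    (hκ0 : 0 ≤ κ') (hK : KB2 K' κ') (δ η : σ → Bool) (p : ℕ) (hp : 1 ≤ p) :
    ∑ ω, ‖Vp X lab K' K δ η ω‖ ^ (2 * p)
      ≤ 2 * Fintype.card d * (2 * p : ℝ) ^ p * ∑ ω, (κ' * gf X lab K (fun s => δ s && !η s) ω) ^ p := by
  have hinv : ∀ l ω, ∀ j : L × A, (fun s => δ s && η s) (lab j.2) = true →
      Ymat X lab K (fun s => δ s && !η s) l (X.f j ω) = Ymat X lab K (fun s => δ s && !η s) l ω := by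
    intro l ω j hj
    refine Ymat_inv X lab K _ l ω j ?_
    simp at hj ⊢
    intro _; exact hj.2
  refine cross X lab K' κ' hκ0 hK (fun s => δ s && η s)
    (fun l ω => Ymat X lab K (fun s => δ s && !η s) l ω) hinv _
    (fun ω => gf_nonneg _ _ _ _ _) ?_ ?_ ?_ p hp
  · intro ω j hj
    unfold gf
    simp only [hinv _ ω j hj]
  · intro ω w
    refine (sum_nsq_le _ _ _).trans (mul_le_mul_of_nonneg_right ?_ (nsq_nonneg _))
    exact le_add_of_nonneg_right (norm_nonneg _)
  · intro ω w
    refine (sum_nsq_le _ _ _).trans (mul_le_mul_of_nonneg_right ?_ (nsq_nonneg _))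
    simp only [transpose_transpose]
    exact le_add_of_nonneg_left (norm_nonneg _)

lemma gf_tr (X : Signs Ωp (L × A)) (lab : A → σ) (K : A → Matrix d d ℝ) (δ : σ → Bool)
    (ω : Ωp) : gf X lab (fun a => (K a)ᵀ) δ ω = gf X lab K δ ω := by
  unfold gf
  simp only [← Ymat_transpose, transpose_transpose]
  rw [add_comm]

lemma gf_le (X : Signs Ωp (L × A)) (lab : A → σ)
    (hlab : ∀ a, (univ.filter fun b => lab a = lab b).card ≤ 2)
    (K : A → Matrix d d ℝ) (κ : ℝ) (hκ0 : 0 ≤ κ) (hK : KB2 K κ) (δ : σ → Bool) (ω : Ωp) :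
    gf X lab K δ ω ≤ ∑ η : σ → Bool, ((Fintype.card (σ → Bool) : ℝ)⁻¹) *
      (4 * Fintype.card L * κ + 4 * ‖Vp X lab (fun a => (K a)ᵀ) K δ η ω‖ +
        4 * ‖Vp X lab K (fun a => (K a)ᵀ) δ η ω‖) := by
  have hc : (Fintype.card (σ → Bool) : ℝ) ≠ 0 := by
    have : 0 < Fintype.card (σ → Bool) := Fintype.card_pos
    positivity
  have e1 : ∑ η : σ → Bool, ((Fintype.card (σ → Bool) : ℝ)⁻¹) * (4 * Fintype.card L * κ)
      = 4 * Fintype.card L * κ := by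
    rw [Finset.sum_const, nsmul_eq_mul, card_univ, ← mul_assoc, mul_inv_cancel₀ hc, one_mul]
  simp only [mul_add ((Fintype.card (σ → Bool) : ℝ)⁻¹), Finset.sum_add_distrib]
  rw [e1]
  unfold gf
  have a1 := offC_norm X lab (fun a => (K a)ᵀ) K δ ω
  have a2 := offC_norm X lab K (fun a => (K a)ᵀ) δ ω
  have b1 := diag_norm X lab hlab (fun a => (K a)ᵀ) K κ hκ0 hK.tr hK δ ω
  have b2 := diag_norm X lab hlab K (fun a => (K a)ᵀ) κ hκ0 hK hK.tr δ ω
  simp only [Ymat_transpose]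
  rw [split_chaos, split_chaos]
  have t1 := norm_add_le (diagC X lab (fun a => (K a)ᵀ) K δ ω) (offC X lab (fun a => (K a)ᵀ) K δ ω)
  have t2 := norm_add_le (diagC X lab K (fun a => (K a)ᵀ) δ ω) (offC X lab K (fun a => (K a)ᵀ) δ ω)
  linarith

lemma avg_pow {ι : Type*} [Fintype ι] [Nonempty ι] (z : ι → ℝ) (hz : ∀ i, 0 ≤ z i) (p : ℕ) :
    (∑ i, (Fintype.card ι : ℝ)⁻¹ * z i) ^ p ≤ ∑ i, (Fintype.card ι : ℝ)⁻¹ * z i ^ p := by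
  refine Real.pow_arith_mean_le_arith_mean_pow univ _ _ (fun i _ => by positivity) ?_
    (fun i _ => hz i) p
  rw [Finset.sum_const, nsmul_eq_mul, card_univ, mul_inv_cancel₀]
  have : 0 < Fintype.card ι := Fintype.card_pos
  positivity

lemma three_pow (a b c : ℝ) (ha : 0 ≤ a) (hb : 0 ≤ b) (hc : 0 ≤ c) (p : ℕ) :
    (a + b + c) ^ p ≤ (3 * a) ^ p + (3 * b) ^ p + (3 * c) ^ p := by
  have h1 : (0:ℝ) ≤ (3 * a) ^ p := by positivity
  have h2 : (0:ℝ) ≤ (3 * b) ^ p := by positivity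
  have h3 : (0:ℝ) ≤ (3 * c) ^ p := by positivity
  have h0 : (0:ℝ) ≤ a + b + c := by positivity
  by_cases hab : b ≤ a
  · by_cases hac : c ≤ a
    · have := pow_le_pow_left₀ h0 (show a + b + c ≤ 3 * a by linarith) p
      linarith
    · have := pow_le_pow_left₀ h0 (show a + b + c ≤ 3 * c by linarith) p
      linarith
  · by_cases hac : c ≤ b
    · have := pow_le_pow_left₀ h0 (show a + b + c ≤ 3 * b by linarith) p
      linarith
    · have := pow_le_pow_left₀ h0 (show a + b + c ≤ 3 * c by linarith) p
      linarith

lemma avg_const {ι : Type*} [Fintype ι] [Nonempty ι] (F : ι → ℝ) (c : ℝ) (h : ∀ i, F i ≤ c) :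
    ∑ i, (Fintype.card ι : ℝ)⁻¹ * F i ≤ c := by
  have : 0 < (Fintype.card ι : ℝ) := by exact_mod_cast Fintype.card_pos
  calc ∑ i, (Fintype.card ι : ℝ)⁻¹ * F i ≤ ∑ i : ι, (Fintype.card ι : ℝ)⁻¹ * c :=
        Finset.sum_le_sum fun i _ => mul_le_mul_of_nonneg_left (h i) (by positivity)
    _ = c := by
        rw [Finset.sum_const, nsmul_eq_mul, card_univ, ← mul_assoc, mul_inv_cancel₀ this.ne', one_mul]

theorem G_thm [Nonempty d] (X : Signs Ωp (L × A)) (lab : A → σ)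
    (hlab : ∀ a, (univ.filter fun b => lab a = lab b).card ≤ 2)
    (K : A → Matrix d d ℝ) (κ : ℝ) (hκ0 : 0 < κ) (hK : KB2 K κ) (p : ℕ) (hp : 1 ≤ p)
    (hpL : p ≤ Fintype.card L) (δ : σ → Bool) :
    ∑ ω, gf X lab K δ ω ^ (2 * p) ≤
      18 * (Fintype.card d * (288 * Fintype.card L * κ) ^ p) ^ 2 * Fintype.card Ωp := by
  obtain ⟨δm, -, hm⟩ := Finset.exists_max_image (univ : Finset (σ → Bool))
    (fun δ => ∑ ω, gf X lab K δ ω ^ (2 * p)) ⟨fun _ => true, mem_univ _⟩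
  refine (hm δ (mem_univ _)).trans ?_
  set M := ∑ ω, gf X lab K δm ω ^ (2 * p) with hM
  set D : ℝ := ((Fintype.card d : ℕ) : ℝ) with hD
  set N : ℝ := ((Fintype.card Ωp : ℕ) : ℝ) with hN
  set l : ℝ := ((Fintype.card L : ℕ) : ℝ) with hl
  have hD1 : 1 ≤ D := by rw [hD]; exact_mod_cast Fintype.card_pos
  have hN0 : 0 ≤ N := by positivity
  have hl0 : (p:ℝ) ≤ l := by rw [hl]; exact_mod_cast hpL
  have hp0 : (1:ℝ) ≤ p := by exact_mod_cast hp
  set c : ℝ := 4 * D * (288 * p * κ) ^ p with hc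
  have hc0 : 0 ≤ c := by positivity
  have young : ∀ β : σ → Bool, c * ∑ ω, gf X lab K β ω ^ p ≤ c ^ 2 / 2 * N + M / 2 := by
    intro β
    rw [Finset.mul_sum]
    calc ∑ ω, c * gf X lab K β ω ^ p ≤ ∑ ω, (c ^ 2 / 2 + gf X lab K β ω ^ (2 * p) / 2) := by
          refine Finset.sum_le_sum fun ω _ => ?_
          rw [mul_comm 2 p, pow_mul]
          nlinarith [sq_nonneg (c - gf X lab K β ω ^ p)]
      _ = c ^ 2 / 2 * N + (∑ ω, gf X lab K β ω ^ (2 * p)) / 2 := by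
          rw [Finset.sum_add_distrib, Finset.sum_const, nsmul_eq_mul, card_univ, Finset.sum_div]
          ring
      _ ≤ _ := by
          have := hm β (mem_univ _)
          linarith
  have hv : ∀ (K₁ K₂ : A → Matrix d d ℝ), KB2 K₁ κ →
      (∀ δ ω, gf X lab K₂ δ ω = gf X lab K δ ω) → ∀ η : σ → Bool,
      ∑ ω, (3 * (4 * ‖Vp X lab K₁ K₂ δm η ω‖)) ^ (2 * p) ≤ (c ^ 2 / 2 * N + M / 2) / 2 := by
    intro K₁ K₂ h1 h2 η
    have v := Vp_mom X lab K₁ K₂ κ hκ0.le h1 δm η p hp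
    simp only [h2] at v
    have y := young (fun s => δm s && !η s)
    calc ∑ ω, (3 * (4 * ‖Vp X lab K₁ K₂ δm η ω‖)) ^ (2 * p)
        = 12 ^ (2 * p) * ∑ ω, ‖Vp X lab K₁ K₂ δm η ω‖ ^ (2 * p) := by
          rw [Finset.mul_sum]
          refine Finset.sum_congr rfl fun ω _ => ?_
          rw [← mul_assoc, mul_pow]; norm_num
      _ ≤ 12 ^ (2 * p) * _ := mul_le_mul_of_nonneg_left v (by positivity)
      _ = (c * ∑ ω, gf X lab K (fun s => δm s && !η s) ω ^ p) / 2 := by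
          simp only [mul_pow κ]
          rw [← Finset.mul_sum, hc, pow_mul, show (288 * (p:ℝ) * κ) = 12 ^ 2 * (2 * p) * κ by ring,
            mul_pow _ κ, mul_pow (12 ^ 2 : ℝ)]
          ring
      _ ≤ _ := by linarith
  have step : M ≤ (12 * l * κ) ^ (2 * p) * N + (c ^ 2 / 2 * N + M / 2) := by
    have pw : ∀ ω, gf X lab K δm ω ^ (2 * p) ≤ ∑ η : σ → Bool, ((Fintype.card (σ → Bool) : ℝ)⁻¹) *
      ((3 * (4 * l * κ)) ^ (2 * p) + (3 * (4 * ‖Vp X lab (fun a => (K a)ᵀ) K δm η ω‖)) ^ (2 * p) +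
        (3 * (4 * ‖Vp X lab K (fun a => (K a)ᵀ) δm η ω‖)) ^ (2 * p)) := by
      intro ω
      refine (pow_le_pow_left₀ (gf_nonneg _ _ _ _ _) (gf_le X lab hlab K κ hκ0.le hK δm ω) _).trans ?_
      refine (avg_pow _ (fun η => by positivity) _).trans ?_
      refine Finset.sum_le_sum fun η _ => mul_le_mul_of_nonneg_left ?_ (by positivity)
      exact three_pow _ _ _ (by positivity) (by positivity) (by positivity) _
    rw [hM]
    refine (Finset.sum_le_sum fun ω _ => pw ω).trans ?_
    rw [Finset.sum_comm]
    simp only [← Finset.mul_sum _ _ ((Fintype.card (σ → Bool) : ℝ)⁻¹)]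
    rw [Finset.mul_sum]
    refine avg_const (ι := σ → Bool) _ _ fun η => ?_
    rw [Finset.sum_add_distrib, Finset.sum_add_distrib, Finset.sum_const, nsmul_eq_mul, card_univ]
    have x1 := hv (fun a => (K a)ᵀ) K hK.tr (fun _ _ => rfl) η
    have x2 := hv K (fun a => (K a)ᵀ) hK (fun _ _ => gf_tr _ _ _ _ _) η
    have e : (3 * (4 * l * κ)) = 12 * l * κ := by ring
    rw [e]
    linarith
  have s2 : M ≤ (2 * (12 * l * κ) ^ (2 * p) + c ^ 2) * N := by linarith
  refine s2.trans (mul_le_mul_of_nonneg_right ?_ hN0)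
  have q1 : (12 * l * κ) ^ (2 * p) ≤ (D * (288 * l * κ) ^ p) ^ 2 := by
    rw [mul_pow D, ← pow_mul, mul_comm p 2]
    have : (12 * l * κ) ^ (2 * p) ≤ (288 * l * κ) ^ (2 * p) := by
      refine pow_le_pow_left₀ (by positivity) ?_ _
      have : 0 < l * κ := by apply mul_pos <;> linarith
      nlinarith
    have h1 : (1:ℝ) ≤ D ^ 2 := one_le_pow₀ hD1
    have h2 : 0 ≤ (288 * l * κ) ^ (2 * p) := by positivity
    nlinarith
  have q2 : c ≤ 4 * (D * (288 * l * κ) ^ p) := by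
    rw [hc, mul_assoc]
    gcongr
  have q3 : c ^ 2 ≤ 16 * (D * (288 * l * κ) ^ p) ^ 2 := by
    calc c ^ 2 ≤ (4 * (D * (288 * l * κ) ^ p)) ^ 2 := pow_le_pow_left₀ hc0 q2 2
      _ = _ := by ring
  linarith

theorem X_thm [Nonempty d] (X : Signs Ωp (L × A)) (lab : A → σ)
    (hlab : ∀ a, (univ.filter fun b => lab a = lab b).card ≤ 2)
    (K' K : A → Matrix d d ℝ) (κ' κ : ℝ) (hκ0' : 0 < κ') (hκ0 : 0 < κ) (hK' : KB2 K' κ')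
    (hK : KB2 K κ) (p : ℕ) (hp : 1 ≤ p)
    (hpL : p ≤ Fintype.card L) (δ : σ → Bool) :
    ∑ ω, ‖offC X lab K' K δ ω‖ ^ (2 * p) ≤
      20 * (Fintype.card d : ℝ) ^ 2 * (9216 * p * Fintype.card L * κ' * κ) ^ p * Fintype.card Ωp := by
  set D : ℝ := ((Fintype.card d : ℕ) : ℝ) with hD
  set N : ℝ := ((Fintype.card Ωp : ℕ) : ℝ) with hN
  set l : ℝ := ((Fintype.card L : ℕ) : ℝ) with hl
  have hD1 : 1 ≤ D := by rw [hD]; exact_mod_cast Fintype.card_pos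
  have hN0 : 0 ≤ N := by positivity
  have hp0 : (1:ℝ) ≤ p := by exact_mod_cast hp
  have hl0 : (p:ℝ) ≤ l := by rw [hl]; exact_mod_cast hpL
  set s : ℝ := D * (288 * l * κ) ^ p with hs
  have hs0 : 0 < s := by
    have : 0 < l := by linarith
    positivity
  have gp : ∀ β : σ → Bool, ∑ ω, gf X lab K β ω ^ p ≤ 10 * s * N := by
    intro β
    have G := G_thm X lab hlab K κ hκ0 hK p hp hpL β
    rw [← hD, ← hl, ← hs, ← hN] at G
    have : s * ∑ ω, gf X lab K β ω ^ p ≤ s * (10 * s * N) := by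
      rw [Finset.mul_sum]
      calc ∑ ω, s * gf X lab K β ω ^ p ≤ ∑ ω, (s ^ 2 / 2 + gf X lab K β ω ^ (2 * p) / 2) := by
            refine Finset.sum_le_sum fun ω _ => ?_
            rw [mul_comm 2 p, pow_mul]
            nlinarith [sq_nonneg (s - gf X lab K β ω ^ p)]
        _ = s ^ 2 / 2 * N + (∑ ω, gf X lab K β ω ^ (2 * p)) / 2 := by
            rw [Finset.sum_add_distrib, Finset.sum_const, nsmul_eq_mul, card_univ, Finset.sum_div]
            ring
        _ ≤ _ := by
            have : 0 ≤ s ^ 2 * N := by positivity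
            nlinarith
    exact le_of_mul_le_mul_left this hs0
  have pw : ∀ ω, ‖offC X lab K' K δ ω‖ ^ (2 * p) ≤
      ∑ η : σ → Bool, ((Fintype.card (σ → Bool) : ℝ)⁻¹) * (4 * ‖Vp X lab K' K δ η ω‖) ^ (2 * p) := by
    intro ω
    refine (pow_le_pow_left₀ (norm_nonneg _) (offC_norm X lab K' K δ ω) _).trans ?_
    exact avg_pow _ (fun η => by positivity) _
  refine (Finset.sum_le_sum fun ω _ => pw ω).trans ?_
  rw [Finset.sum_comm]
  simp only [← Finset.mul_sum _ _ ((Fintype.card (σ → Bool) : ℝ)⁻¹)]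
  rw [Finset.mul_sum]
  refine avg_const (ι := σ → Bool) _ _ fun η => ?_
  have v := Vp_mom X lab K' K κ' hκ0'.le hK' δ η p hp
  calc ∑ ω, (4 * ‖Vp X lab K' K δ η ω‖) ^ (2 * p)
      = 4 ^ (2 * p) * ∑ ω, ‖Vp X lab K' K δ η ω‖ ^ (2 * p) := by
        rw [Finset.mul_sum]
        refine Finset.sum_congr rfl fun ω _ => ?_
        rw [mul_pow]
    _ ≤ 4 ^ (2 * p) * _ := mul_le_mul_of_nonneg_left v (by positivity)
    _ = 4 ^ (2 * p) * (2 * D * (2 * p : ℝ) ^ p * κ' ^ p) *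
          ∑ ω, gf X lab K (fun s => δ s && !η s) ω ^ p := by
        simp only [mul_pow κ']
        rw [← Finset.mul_sum]; ring
    _ ≤ 4 ^ (2 * p) * (2 * D * (2 * p : ℝ) ^ p * κ' ^ p) * (10 * s * N) :=
        mul_le_mul_of_nonneg_left (gp _) (by positivity)
    _ = _ := by
        rw [hs, pow_mul, show 9216 * (p:ℝ) * l * κ' * κ = 4 ^ 2 * (2 * p) * κ' * (288 * l * κ) by ring,
          mul_pow _ (288 * l * κ), mul_pow _ κ', mul_pow (4 ^ 2 : ℝ)]
        ring
end
end KB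

set_option linter.unusedSectionVars false
namespace KB
open Finset Matrix
open scoped Matrix.Norms.L2Operator
section
variable {τ α : Type*} [Fintype τ] [DecidableEq τ] [Fintype α] [DecidableEq α]

/-- slot permutation matrix -/
def PM (π : Equiv.Perm τ) : Matrix (τ → α) (τ → α) ℝ := fun x y => if y = x ∘ π then 1 else 0

lemma PM_mulVec (π : Equiv.Perm τ) (w : (τ → α) → ℝ) (x : τ → α) : (PM π *ᵥ w) x = w (x ∘ π) := by
  simp [mulVec, dotProduct, PM]

lemma PM_mul_apply (π : Equiv.Perm τ) (M : Matrix (τ → α) (τ → α) ℝ) (x y : τ → α) :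
    (PM π * M : Matrix (τ → α) (τ → α) ℝ) x y = M (x ∘ π) y := by
  simp [Matrix.mul_apply, PM]

lemma mul_PM_apply (π : Equiv.Perm τ) (M : Matrix (τ → α) (τ → α) ℝ) (x y : τ → α) :
    (M * PM π : Matrix (τ → α) (τ → α) ℝ) x (y ∘ π) = M x y := by
  have : ∀ z : τ → α, (y ∘ π = z ∘ π) ↔ y = z := by
    intro z
    constructor
    · intro h; funext t
      have := congrFun h (π.symm t); simpa using this
    · rintro rfl; rfl
  simp [Matrix.mul_apply, PM, this]

lemma PM_mul (π σ : Equiv.Perm τ) : (PM π : Matrix (τ → α) (τ → α) ℝ) * PM σ = PM (π * σ) := by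
  ext x y
  rw [PM_mul_apply]
  rfl

lemma PM_transpose (π : Equiv.Perm τ) : (PM π : Matrix (τ → α) (τ → α) ℝ)ᵀ = PM π⁻¹ := by
  ext x y
  simp only [transpose_apply, PM]
  congr 1
  apply propext
  constructor
  · rintro rfl; funext t; simp
  · rintro rfl; funext t; simp

lemma PM_comm (π : Equiv.Perm τ) (M : Matrix (τ → α) (τ → α) ℝ)
    (h : ∀ x y, M (x ∘ π) (y ∘ π) = M x y) : PM π * M = M * PM π := by
  ext x y
  obtain ⟨y, rfl⟩ : ∃ z, y = z ∘ π := ⟨y ∘ π.symm, by funext t; simp⟩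
  rw [PM_mul_apply, mul_PM_apply, h]

/-- permutations supported in `S` -/
def GS (S : Finset τ) : Finset (Equiv.Perm τ) := univ.filter fun π => ∀ t, t ∉ S → π t = t

lemma mem_GS (S : Finset τ) (π : Equiv.Perm τ) : π ∈ GS S ↔ ∀ t, t ∉ S → π t = t := by
  simp [GS]

lemma GS_mul {S : Finset τ} {π σ : Equiv.Perm τ} (h1 : π ∈ GS S) (h2 : σ ∈ GS S) :
    π * σ ∈ GS S := by
  rw [mem_GS] at *
  intro t ht
  rw [Equiv.Perm.mul_apply, h2 t ht, h1 t ht]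

lemma GS_inv {S : Finset τ} {π : Equiv.Perm τ} (h1 : π ∈ GS S) : π⁻¹ ∈ GS S := by
  rw [mem_GS] at *
  intro t ht
  rw [Equiv.Perm.inv_eq_iff_eq, h1 t ht]

lemma GS_card_pos (S : Finset τ) : 0 < ((GS S).card : ℝ) := by
  have : (1 : Equiv.Perm τ) ∈ GS S := by rw [mem_GS]; intros; rfl
  exact_mod_cast Finset.card_pos.2 ⟨_, this⟩

/-- symmetrizer on the slots in `S` -/
noncomputable def PS (S : Finset τ) : Matrix (τ → α) (τ → α) ℝ :=
  ((GS S).card : ℝ)⁻¹ • ∑ π ∈ GS S, PM π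

lemma GS_sum_left {β : Type*} [AddCommMonoid β] (S : Finset τ) {π : Equiv.Perm τ} (h : π ∈ GS S)
    (F : Equiv.Perm τ → β) : ∑ σ ∈ GS S, F (π * σ) = ∑ σ ∈ GS S, F σ := by
  refine Finset.sum_equiv (Equiv.mulLeft π) (fun σ => ?_) (fun σ _ => rfl)
  refine ⟨fun hh => GS_mul h hh, fun hh => ?_⟩
  have := GS_mul (GS_inv h) hh
  simpa using this

lemma GS_sum_right {β : Type*} [AddCommMonoid β] (S : Finset τ) {π : Equiv.Perm τ} (h : π ∈ GS S)
    (F : Equiv.Perm τ → β) : ∑ σ ∈ GS S, F (σ * π) = ∑ σ ∈ GS S, F σ := by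
  refine Finset.sum_equiv (Equiv.mulRight π) (fun σ => ?_) (fun σ _ => rfl)
  refine ⟨fun hh => GS_mul hh h, fun hh => ?_⟩
  have := GS_mul hh (GS_inv h)
  simpa using this

lemma PM_mul_PS {S : Finset τ} {π : Equiv.Perm τ} (h : π ∈ GS S) :
    PM π * PS S = (PS S : Matrix (τ → α) (τ → α) ℝ) := by
  unfold PS
  rw [Matrix.mul_smul, Finset.mul_sum]
  simp only [PM_mul]
  rw [GS_sum_left S h]

lemma PS_mul_PM {S : Finset τ} {π : Equiv.Perm τ} (h : π ∈ GS S) :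
    PS S * PM π = (PS S : Matrix (τ → α) (τ → α) ℝ) := by
  unfold PS
  rw [Matrix.smul_mul, Finset.sum_mul]
  simp only [PM_mul]
  rw [GS_sum_right S h (fun σ => (PM σ : Matrix (τ → α) (τ → α) ℝ))]

lemma GS_mono {S S' : Finset τ} (h : S ⊆ S') : GS S ⊆ GS S' := by
  intro π hπ
  rw [mem_GS] at *
  exact fun t ht => hπ t fun h' => ht (h h')

lemma PS_mul_PS {S S' : Finset τ} (h : S ⊆ S') :
    PS S * PS S' = (PS S' : Matrix (τ → α) (τ → α) ℝ) := by
  conv_lhs => rw [PS]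
  rw [Matrix.smul_mul, Finset.sum_mul, Finset.sum_congr rfl fun π hπ => PM_mul_PS (GS_mono h hπ),
    Finset.sum_const, ← Nat.cast_smul_eq_nsmul ℝ, smul_smul, inv_mul_cancel₀ (GS_card_pos S).ne',
    one_smul]

lemma PS_mul_PS' {S S' : Finset τ} (h : S ⊆ S') :
    PS S' * PS S = (PS S' : Matrix (τ → α) (τ → α) ℝ) := by
  conv_lhs => rw [PS, PS, ← PS]
  rw [Matrix.mul_smul, Finset.mul_sum, Finset.sum_congr rfl fun π hπ => PS_mul_PM (GS_mono h hπ),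
    Finset.sum_const, ← Nat.cast_smul_eq_nsmul ℝ, smul_smul, inv_mul_cancel₀ (GS_card_pos S).ne',
    one_smul]

lemma PS_transpose (S : Finset τ) : (PS S : Matrix (τ → α) (τ → α) ℝ)ᵀ = PS S := by
  unfold PS
  rw [transpose_smul, transpose_sum]
  congr 1
  simp only [PM_transpose]
  refine Finset.sum_equiv (Equiv.inv _) (fun σ => ?_) (fun σ _ => rfl)
  refine ⟨fun hh => GS_inv hh, fun hh => ?_⟩
  have := GS_inv hh
  simpa using this

lemma PS_norm (S : Finset τ) : ‖(PS S : Matrix (τ → α) (τ → α) ℝ)‖ ≤ 1 := by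
  have h := l2_opNorm_conjTranspose_mul_self (PS S : Matrix (τ → α) (τ → α) ℝ)
  rw [conjTranspose_eq_transpose_of_trivial, PS_transpose, PS_mul_PS (Subset.refl S)] at h
  by_contra hc
  push Not at hc
  nlinarith

lemma nsq_PS_le (S : Finset τ) (w : (τ → α) → ℝ) : nsq (PS S *ᵥ w) ≤ nsq w := by
  have h1 := nsq_mulVec_le (PS S) w
  have h2 := PS_norm (α := α) S
  have h3 := nsq_nonneg w
  have h4 : ‖(PS S : Matrix (τ → α) (τ → α) ℝ)‖ ^ 2 ≤ 1 := pow_le_one₀ (norm_nonneg _) h2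
  nlinarith

lemma PS_comm (S : Finset τ) (M : Matrix (τ → α) (τ → α) ℝ)
    (h : ∀ π ∈ GS S, ∀ x y, M (x ∘ π) (y ∘ π) = M x y) : PS S * M = M * PS S := by
  unfold PS
  rw [Matrix.smul_mul, Matrix.mul_smul, Finset.sum_mul, Finset.mul_sum]
  congr 1
  exact Finset.sum_congr rfl fun π hπ => PM_comm π M (h π hπ)

/-- single-slot operator -/
def op (t : τ) (M : Matrix α α ℝ) : Matrix (τ → α) (τ → α) ℝ :=
  fun x y => if (∀ s, s ≠ t → x s = y s) then M (x t) (y t) else 0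

lemma off_perm {S : Finset τ} {π : Equiv.Perm τ} (hπ : π ∈ GS S) (Q : τ → Prop)
    (hQ : ∀ t, Q t → t ∉ S) (x y : τ → α) :
    (∀ s, ¬ Q s → (x ∘ π) s = (y ∘ π) s) ↔ (∀ s, ¬ Q s → x s = y s) := by
  have hh := (mem_GS S π).1 hπ
  have key : ∀ (ρ : Equiv.Perm τ), ρ ∈ GS S → ∀ s, ¬ Q s → ¬ Q (ρ s) := by
    intro ρ hρ s hs hq
    have := (mem_GS S ρ).1 hρ _ (hQ _ hq)
    have := ρ.injective this
    rw [this] at hq; exact hs hq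
  constructor
  · intro h s hs
    have := h (π⁻¹ s) (key _ (GS_inv hπ) s hs)
    simpa using this
  · intro h s hs
    exact h (π s) (key _ hπ s hs)

lemma PS_op (S : Finset τ) (t : τ) (ht : t ∉ S) (M : Matrix α α ℝ) :
    PS S * op t M = op t M * PS S := by
  refine PS_comm S _ fun π hπ x y => ?_
  unfold op
  have := off_perm hπ (fun s => s = t) (by rintro _ rfl; exact ht) x y
  have h2 := (mem_GS S π).1 hπ t ht
  simp only [← ne_eq] at this
  rw [if_congr this rfl rfl]
  simp [h2]

lemma PS_comm_disj (S S' : Finset τ) (h : Disjoint S S') :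
    PS S * PS S' = (PS S' * PS S : Matrix (τ → α) (τ → α) ℝ) := by
  conv_lhs => rw [PS, PS]
  conv_rhs => rw [PS, PS]
  simp only [Matrix.smul_mul, Matrix.mul_smul, Finset.sum_mul, Finset.mul_sum, smul_sum, smul_smul]
  rw [Finset.sum_comm]
  refine Finset.sum_congr rfl fun π hπ => Finset.sum_congr rfl fun σ hσ => ?_
  rw [PM_mul, PM_mul, mul_comm]
  congr 2
  rw [mem_GS] at *
  have hd := Finset.disjoint_left.1 h
  ext t
  simp only [Equiv.Perm.mul_apply]
  by_cases h1 : t ∈ S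
  · have h2 := hd h1
    by_cases h3 : π t ∈ S
    · rw [hσ _ h2, hσ _ (hd h3)]
    · have := hπ _ h3
      have := π.injective this
      rw [this] at h3; exact absurd h1 h3
  · by_cases h3 : σ t ∈ S
    · by_cases h4 : t ∈ S'
      · have := hσ _ (hd h3)
        have := σ.injective this
        rw [this] at h3; exact absurd h3 h1
      · rw [hσ t h4, hπ t h1, hσ t h4]
    · rw [hπ _ h3, hπ _ h1]

lemma op_mulVec (t : τ) (M : Matrix α α ℝ) (w : (τ → α) → ℝ) (x : τ → α) :
    (op t M *ᵥ w) x = ∑ j, M (x t) j * w (Function.update x t j) := by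
  simp only [mulVec, dotProduct, op]
  simp only [ite_mul, zero_mul]
  rw [← Finset.sum_filter]
  refine Finset.sum_bij' (fun y _ => y t) (fun j _ => Function.update x t j) ?_ ?_ ?_ ?_ ?_
  · simp
  · intro j _; simp only [mem_filter, mem_univ, true_and]
    intro s hs; simp [hs]
  · intro y hy
    simp only [mem_filter, mem_univ, true_and] at hy
    funext s
    by_cases h : s = t
    · subst h; simp
    · simp [h, hy s h]
  · simp
  · intro y hy
    simp only [mem_filter, mem_univ, true_and] at hy
    have : Function.update x t (y t) = y := by
      funext s
      by_cases h : s = t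
      · subst h; simp
      · simp [h, hy s h]
    rw [this]

lemma opE_mulVec (t : τ) (i j : α) (w : (τ → α) → ℝ) (x : τ → α) :
    (op t (Matrix.single i j (1:ℝ)) *ᵥ w) x = if x t = i then w (Function.update x t j) else 0 := by
  rw [op_mulVec]
  rw [Finset.sum_eq_single j]
  · simp [Matrix.single_apply, eq_comm]
  · intro b _ hb
    simp [Matrix.single_apply, Ne.symm hb]
  · simp

lemma pt_bilin (t s : τ) (w w' : (τ → α) → ℝ) :
    ∑ i, ∑ j, (op t (Matrix.single i j (1:ℝ)) *ᵥ w) ⬝ᵥ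
      (PM (Equiv.swap t s) *ᵥ (op t (Matrix.single i j (1:ℝ)) *ᵥ w'))
      = (if s = t then (Fintype.card α : ℝ) else 1) * (w ⬝ᵥ w') := by
  have h1 : ∀ i j, (op t (Matrix.single i j (1:ℝ)) *ᵥ w) ⬝ᵥ
      (PM (Equiv.swap t s) *ᵥ (op t (Matrix.single i j (1:ℝ)) *ᵥ w'))
      = ∑ x : τ → α, if x t = i then (if x s = x t then
        w (Function.update x t j) * w' (Function.update x t j) else 0) else 0 := by
    intro i j
    unfold dotProduct
    refine Finset.sum_congr rfl fun x _ => ?_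
    rw [PM_mulVec, opE_mulVec, opE_mulVec]
    simp only [Function.comp_apply, Equiv.swap_apply_left]
    by_cases h : x t = i
    · rw [if_pos h, if_pos h, h]
      by_cases h' : x s = i
      · rw [if_pos h', if_pos h']
        have : x ∘ (Equiv.swap t s) = x := by
          funext r
          simp only [Function.comp_apply, Equiv.swap_apply_def]
          split_ifs with a b
          · rw [a, h, h']
          · rw [b, h, h']
          · rfl
        rw [this]
      · rw [if_neg h', if_neg h', mul_zero]
    · rw [if_neg h, if_neg h, zero_mul]
  simp only [h1]
  have h2 : ∑ i : α, ∑ j : α, ∑ x : τ → α, (if x t = i then (if x s = x t then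
        w (Function.update x t j) * w' (Function.update x t j) else 0) else 0)
      = ∑ p : (τ → α) × α, (if p.1 s = p.1 t then
        w (Function.update p.1 t p.2) * w' (Function.update p.1 t p.2) else 0) := by
    rw [Fintype.sum_prod_type, Finset.sum_comm]
    simp only
    conv_rhs => rw [Finset.sum_comm]
    refine Finset.sum_congr rfl fun j _ => ?_
    rw [Finset.sum_comm]
    refine Finset.sum_congr rfl fun x _ => ?_
    simp
  rw [h2]
  let Φ : ((τ → α) × α) ≃ ((τ → α) × α) :=
    { toFun := fun p => (Function.update p.1 t p.2, p.1 t)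
      invFun := fun p => (Function.update p.1 t p.2, p.1 t)
      left_inv := fun p => by simp
      right_inv := fun p => by simp }
  rw [← Equiv.sum_comp Φ, Fintype.sum_prod_type, dotProduct, Finset.mul_sum]
  refine Finset.sum_congr rfl fun y _ => ?_
  simp only [Φ, Equiv.coe_fn_mk, Function.update_self, Function.update_idem,
    Function.update_eq_self]
  by_cases h : s = t
  · subst h; simp
  · simp [h]

lemma GS_bij {β : Type*} [AddCommMonoid β] (S : Finset τ) (t : τ) (ht : t ∈ S)
    (F : Equiv.Perm τ → β) :
    ∑ ρ ∈ GS S, F ρ = ∑ s ∈ S, ∑ π ∈ GS (S.erase t), F (Equiv.swap t s * π) := by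
  rw [← Finset.sum_product']
  symm
  have fixt : ∀ π ∈ GS (S.erase t), π t = t := by
    intro π hπ
    exact (mem_GS _ _).1 hπ t (by simp)
  refine Finset.sum_bij' (fun p _ => Equiv.swap t p.1 * p.2)
    (fun ρ _ => (ρ t, Equiv.swap t (ρ t) * ρ)) ?_ ?_ ?_ ?_ ?_
  · rintro ⟨s, π⟩ h
    rw [Finset.mem_product] at h
    refine GS_mul ?_ (GS_mono (Finset.erase_subset _ _) h.2)
    rw [mem_GS]
    intro r hr
    refine Equiv.swap_apply_of_ne_of_ne ?_ ?_
    · rintro rfl; exact hr ht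
    · rintro rfl; exact hr h.1
  · intro ρ hρ
    have hρ' := (mem_GS _ _).1 hρ
    rw [Finset.mem_product]
    have hm : ρ t ∈ S := by
      by_contra hc
      have := hρ' _ hc
      have := ρ.injective this
      rw [this] at hc; exact hc ht
    refine ⟨hm, ?_⟩
    rw [mem_GS]
    intro r hr
    simp only [Equiv.Perm.mul_apply]
    by_cases h : r = t
    · subst h; simp
    · have hr' : r ∉ S := fun h' => hr (Finset.mem_erase.2 ⟨h, h'⟩)
      rw [hρ' r hr']
      refine Equiv.swap_apply_of_ne_of_ne h ?_
      rintro rfl; exact hr' hm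
  · rintro ⟨s, π⟩ h
    rw [Finset.mem_product] at h
    have := fixt π h.2
    simp [this, ← mul_assoc]
  · intro ρ hρ
    simp [← mul_assoc]
  · intro p _; rfl

lemma PS_split (S : Finset τ) (t : τ) (ht : t ∈ S) :
    (PS S : Matrix (τ → α) (τ → α) ℝ)
      = (S.card : ℝ)⁻¹ • ∑ s ∈ S, PM (Equiv.swap t s) * PS (S.erase t) := by
  have hc : ((GS S).card : ℝ) = S.card * (GS (S.erase t)).card := by
    have := GS_bij S t ht (fun _ => (1:ℕ))
    simp at this
    exact_mod_cast this
  unfold PS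
  rw [GS_bij S t ht, hc, mul_inv, ← smul_smul]
  congr 1
  rw [Finset.smul_sum]
  refine Finset.sum_congr rfl fun s _ => ?_
  rw [Matrix.mul_smul, Finset.mul_sum]
  simp only [PM_mul]

lemma pt_bound (S : Finset τ) (t : τ) (ht : t ∈ S) (w : (τ → α) → ℝ) (κ : ℝ)
    (hκ : (Fintype.card α : ℝ) + S.card ≤ κ * S.card) :
    ∑ i, ∑ j, nsq (PS S *ᵥ (op t (Matrix.single i j (1:ℝ)) *ᵥ w)) ≤ κ * nsq w := by
  have hS : 0 < (S.card : ℝ) := by exact_mod_cast Finset.card_pos.2 ⟨t, ht⟩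
  have h1 : ∀ i j, nsq (PS S *ᵥ (op t (Matrix.single i j (1:ℝ)) *ᵥ w))
      = (S.card : ℝ)⁻¹ * ∑ s ∈ S, (op t (Matrix.single i j (1:ℝ)) *ᵥ w) ⬝ᵥ
      (PM (Equiv.swap t s) *ᵥ (op t (Matrix.single i j (1:ℝ)) *ᵥ (PS (S.erase t) *ᵥ w))) := by
    intro i j
    set u := op t (Matrix.single i j (1:ℝ)) *ᵥ w with hu
    have e1 : nsq (PS S *ᵥ u) = u ⬝ᵥ (PS S *ᵥ u) := by
      unfold nsq
      rw [← dot_transpose_mul, PS_transpose, PS_mul_PS (Subset.refl S)]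
    rw [e1, PS_split S t ht, Matrix.smul_mulVec, dotProduct_smul, Matrix.sum_mulVec, dotProduct_sum,
      smul_eq_mul]
    refine congrArg (fun z => (S.card : ℝ)⁻¹ * z) ?_
    refine Finset.sum_congr rfl fun s _ => ?_
    refine congrArg (fun z => u ⬝ᵥ z) ?_
    rw [← mulVec_mulVec, hu]
    refine congrArg (fun z => PM (Equiv.swap t s) *ᵥ z) ?_
    rw [mulVec_mulVec, mulVec_mulVec, PS_op _ _ (by simp)]
  simp only [h1, ← Finset.mul_sum]
  have h2 : ∑ i : α, ∑ j : α, ∑ s ∈ S, (op t (Matrix.single i j (1:ℝ)) *ᵥ w) ⬝ᵥ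
      (PM (Equiv.swap t s) *ᵥ (op t (Matrix.single i j (1:ℝ)) *ᵥ (PS (S.erase t) *ᵥ w)))
      = (∑ s ∈ S, (if s = t then (Fintype.card α : ℝ) else 1)) * (w ⬝ᵥ (PS (S.erase t) *ᵥ w)) := by
    rw [Finset.sum_mul, Finset.sum_congr rfl fun s _ => (pt_bilin t s w _).symm]
    rw [Finset.sum_comm]
    conv_rhs => rw [Finset.sum_comm]
    conv_rhs =>
      enter [2, i]
      rw [Finset.sum_comm]
    rw [Finset.sum_comm]
  rw [h2]
  have h3 : ∑ s ∈ S, (if s = t then (Fintype.card α : ℝ) else 1) ≤ Fintype.card α + S.card := by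
    calc _ ≤ ∑ s ∈ S, ((if s = t then (Fintype.card α : ℝ) else 0) + 1) := by
          refine Finset.sum_le_sum fun s _ => ?_
          split_ifs <;> simp
      _ = _ := by rw [Finset.sum_add_distrib]; simp [ht]
  have h4 : w ⬝ᵥ (PS (S.erase t) *ᵥ w) ≤ nsq w := by
    have := dot_le_half w (PS (S.erase t) *ᵥ w)
    have := nsq_PS_le (S.erase t) w
    linarith
  have h5 : 0 ≤ ∑ s ∈ S, (if s = t then (Fintype.card α : ℝ) else 1) := by
    refine Finset.sum_nonneg fun s _ => ?_
    split_ifs <;> positivity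
  have h6 := nsq_nonneg w
  calc _ ≤ (S.card : ℝ)⁻¹ * ((κ * S.card) * nsq w) := by
        refine mul_le_mul_of_nonneg_left ?_ (by positivity)
        calc _ ≤ (∑ s ∈ S, (if s = t then (Fintype.card α : ℝ) else 1)) * nsq w :=
              mul_le_mul_of_nonneg_left h4 h5
          _ ≤ _ := mul_le_mul_of_nonneg_right (h3.trans hκ) h6
    _ = _ := by field_simp

/-- symmetrized matrix unit -/
noncomputable def Fm (a : α × α) : Matrix α α ℝ :=
  (2:ℝ)⁻¹ • (Matrix.single a.1 a.2 (1:ℝ) + Matrix.single a.2 a.1 (1:ℝ))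

lemma op_add (t : τ) (M M' : Matrix α α ℝ) : op t (M + M') = op t M + op t M' := by
  ext x y; simp only [op, Matrix.add_apply]; split_ifs <;> simp

lemma op_smul (t : τ) (c : ℝ) (M : Matrix α α ℝ) : op t (c • M) = c • op t M := by
  ext x y; simp only [op, Matrix.smul_apply]; split_ifs <;> simp

lemma op_sum {ι : Type*} (s : Finset ι) (t : τ) (M : ι → Matrix α α ℝ) :
    op t (∑ i ∈ s, M i) = ∑ i ∈ s, op t (M i) := by
  ext x y; simp only [op, Matrix.sum_apply]; split_ifs <;> simp

lemma op_transpose (t : τ) (M : Matrix α α ℝ) : (op t M)ᵀ = op t Mᵀ := by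
  ext x y; simp only [op, transpose_apply]
  congr 1
  apply propext
  exact ⟨fun h s hs => (h s hs).symm, fun h s hs => (h s hs).symm⟩

lemma Fm_transpose (a : α × α) : (Fm a)ᵀ = Fm a := by
  unfold Fm
  rw [transpose_smul, transpose_add, transpose_single, transpose_single, add_comm]

lemma nsq_half_add {d : Type*} [Fintype d] (u v : d → ℝ) :
    nsq ((2:ℝ)⁻¹ • (u + v)) ≤ (nsq u + nsq v) / 2 := by
  unfold nsq dotProduct
  rw [← Finset.sum_add_distrib, Finset.sum_div]
  refine Finset.sum_le_sum fun i _ => ?_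
  simp only [Pi.smul_apply, Pi.add_apply, smul_eq_mul]
  nlinarith [sq_nonneg (u i - v i)]

lemma pt_bound_F (S : Finset τ) (t : τ) (ht : t ∈ S) (w : (τ → α) → ℝ) (κ : ℝ)
    (hκ : (Fintype.card α : ℝ) + S.card ≤ κ * S.card) :
    ∑ a, nsq (PS S *ᵥ (op t (Fm a) *ᵥ w)) ≤ κ * nsq w := by
  have h := pt_bound S t ht w κ hκ
  rw [Fintype.sum_prod_type]
  calc ∑ i, ∑ j, nsq (PS S *ᵥ (op t (Fm (i, j)) *ᵥ w))
      ≤ ∑ i, ∑ j, (nsq (PS S *ᵥ (op t (Matrix.single i j (1:ℝ)) *ᵥ w)) +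
        nsq (PS S *ᵥ (op t (Matrix.single j i (1:ℝ)) *ᵥ w))) / 2 := by
        refine Finset.sum_le_sum fun i _ => Finset.sum_le_sum fun j _ => ?_
        have := nsq_half_add (PS S *ᵥ (op t (Matrix.single i j (1:ℝ)) *ᵥ w))
          (PS S *ᵥ (op t (Matrix.single j i (1:ℝ)) *ᵥ w))
        rw [← mulVec_add, ← add_mulVec, ← op_add, ← mulVec_smul, ← smul_mulVec, ← op_smul] at this
        exact this
    _ = (∑ i, ∑ j, nsq (PS S *ᵥ (op t (Matrix.single i j (1:ℝ)) *ᵥ w)) +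
          ∑ i, ∑ j, nsq (PS S *ᵥ (op t (Matrix.single j i (1:ℝ)) *ᵥ w))) / 2 := by
        simp only [← Finset.sum_add_distrib, Finset.sum_div]
    _ ≤ _ := by
        have e : ∑ i, ∑ j, nsq (PS S *ᵥ (op t (Matrix.single j i (1:ℝ)) *ᵥ w))
          = ∑ i, ∑ j, nsq (PS S *ᵥ (op t (Matrix.single i j (1:ℝ)) *ᵥ w)) := Finset.sum_comm
        rw [e]; linarith

/-- slot family -/
noncomputable def Kf (S S' : Finset τ) (t : τ) (a : α × α) : Matrix (τ → α) (τ → α) ℝ :=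
  PS S * op t (Fm a) * PS S'

lemma Kf_KB2 (S S' : Finset τ) (t : τ) (ht : t ∈ S) (ht' : t ∈ S') (κ : ℝ) (h0 : 0 ≤ κ)
    (hκ : (Fintype.card α : ℝ) + S.card ≤ κ * S.card)
    (hκ' : (Fintype.card α : ℝ) + S'.card ≤ κ * S'.card) :
    KB2 (Kf S S' t : α × α → Matrix (τ → α) (τ → α) ℝ) κ := by
  constructor
  · intro w
    simp only [Kf, ← mulVec_mulVec]
    exact (pt_bound_F S t ht _ κ hκ).trans (mul_le_mul_of_nonneg_left (nsq_PS_le _ _) h0)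
  · intro w
    simp only [Kf, transpose_mul, PS_transpose, op_transpose, Fm_transpose, ← mulVec_mulVec]
    exact (pt_bound_F S' t ht' _ κ hκ').trans (mul_le_mul_of_nonneg_left (nsq_PS_le _ _) h0)
end
end KB

set_option linter.unusedSectionVars false
namespace KB
open Finset Matrix
open scoped Matrix.Norms.L2Operator
section
variable {α : Type*} [Fintype α] [DecidableEq α] {N : ℕ} [NeZero N]

/-- slot number `k` -/
def sl (N : ℕ) [NeZero N] (k : ℕ) : Fin N := Fin.ofNat N k

lemma sl_val {k : ℕ} (h : k < N) : (sl N k : ℕ) = k := Nat.mod_eq_of_lt h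

/-- slots below `k` -/
def Lo (N k : ℕ) : Finset (Fin N) := univ.filter fun s => (s : ℕ) < k
/-- slots from `k` on -/
def Hi (N k : ℕ) : Finset (Fin N) := univ.filter fun s => k ≤ (s : ℕ)

lemma mem_Lo {k : ℕ} {s : Fin N} : s ∈ Lo N k ↔ (s : ℕ) < k := by simp [Lo]
lemma mem_Hi {k : ℕ} {s : Fin N} : s ∈ Hi N k ↔ k ≤ (s : ℕ) := by simp [Hi]

lemma Lo_mono {k l : ℕ} (h : k ≤ l) : Lo N k ⊆ Lo N l := by
  intro s hs; rw [mem_Lo] at *; omega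
lemma Hi_mono {k l : ℕ} (h : k ≤ l) : Hi N l ⊆ Hi N k := by
  intro s hs; rw [mem_Hi] at *; omega
lemma Lo_Hi {k l : ℕ} (h : k ≤ l) : Disjoint (Lo N k) (Hi N l) := by
  rw [Finset.disjoint_left]
  intro s hs; rw [mem_Lo] at hs; rw [mem_Hi]; omega

lemma Lo_card {k : ℕ} (h : k ≤ N) : (Lo N k).card = k := by
  unfold Lo
  rw [Fin.card_filter_val_lt]
  omega

lemma Hi_card {k : ℕ} (h : k ≤ N) : (Hi N k).card = N - k := by
  have h1 : (Lo N k).card + (Hi N k).card = N := by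
    have := Finset.card_filter_add_card_filter_not (s := (univ : Finset (Fin N)))
      (fun s => (s : ℕ) < k)
    simp only [not_lt] at this
    rw [card_univ, Fintype.card_fin] at this
    exact this
  rw [Lo_card h] at h1; omega

/-- two-slot operator on the `g`-th pair -/
def T2 (N : ℕ) [NeZero N] (g : ℕ) (M : α × α → α × α → ℝ) : Matrix (Fin N → α) (Fin N → α) ℝ :=
  fun x y => if (∀ s : Fin N, ¬ ((s : ℕ) = 2 * g ∨ (s : ℕ) = 2 * g + 1) → x s = y s) then
    M (x (sl N (2 * g)), x (sl N (2 * g + 1))) (y (sl N (2 * g)), y (sl N (2 * g + 1))) else 0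

lemma PS_T2 (S : Finset (Fin N)) (g : ℕ) (hg : 2 * g + 1 < N) (h1 : sl N (2 * g) ∉ S)
    (h2 : sl N (2 * g + 1) ∉ S) (M : α × α → α × α → ℝ) :
    PS S * T2 N g M = T2 N g M * PS S := by
  refine PS_comm S _ fun π hπ x y => ?_
  unfold T2
  have := off_perm hπ (fun s => (s : ℕ) = 2 * g ∨ (s : ℕ) = 2 * g + 1) (by
    rintro s (h | h)
    · have : s = sl N (2 * g) := Fin.ext (by rw [h, sl_val (by omega)])
      rw [this]; exact h1
    · have : s = sl N (2 * g + 1) := Fin.ext (by rw [h, sl_val (by omega)])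
      rw [this]; exact h2) x y
  have e1 := (mem_GS S π).1 hπ _ h1
  have e2 := (mem_GS S π).1 hπ _ h2
  rw [if_congr this rfl rfl]
  simp [e1, e2]

/-- partial chain -/
def Qc (N : ℕ) [NeZero N] (M : α × α → α × α → ℝ) : ℕ → Matrix (Fin N → α) (Fin N → α) ℝ
  | 0 => 1
  | g + 1 => T2 N g M * Qc N M g

/-- one symmetrized factor -/
noncomputable def Xc (N : ℕ) [NeZero N] (M : α × α → α × α → ℝ) (g : ℕ) :
    Matrix (Fin N → α) (Fin N → α) ℝ :=
  PS (Lo N (2 * g + 2)) * T2 N g M * PS (Hi N (2 * g))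

/-- product of symmetrized factors -/
noncomputable def Rc (N : ℕ) [NeZero N] (M : α × α → α × α → ℝ) :
    ℕ → Matrix (Fin N → α) (Fin N → α) ℝ
  | 0 => PS univ
  | g + 1 => Xc N M g * Rc N M g

lemma PS_Qc (M : α × α → α × α → ℝ) (k : ℕ) : ∀ g, 2 * g ≤ k → 2 * g ≤ N →
    PS (Hi N k) * Qc N M g = Qc N M g * PS (Hi N k) := by
  intro g
  induction g with
  | zero => intro _ _; simp [Qc]
  | succ g ih =>
    intro h1 h2
    simp only [Qc]
    rw [← Matrix.mul_assoc, PS_T2 _ g (by omega), Matrix.mul_assoc, ih (by omega) (by omega),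
      Matrix.mul_assoc]
    · rw [mem_Hi, sl_val (by omega)]; omega
    · rw [mem_Hi, sl_val (by omega)]; omega

lemma Rc_eq (M : α × α → α × α → ℝ) : ∀ g, 2 * g ≤ N →
    Rc N M g = PS (Lo N (2 * g)) * Qc N M g * PS univ := by
  intro g
  induction g with
  | zero =>
    intro _
    simp only [Rc, Qc, Matrix.mul_one]
    rw [PS_mul_PS (subset_univ _)]
  | succ g ih =>
    intro h
    simp only [Rc, Qc]
    rw [ih (by omega), Xc]
    have c1 : PS (Hi N (2 * g)) * (PS (Lo N (2 * g)) * Qc N M g * PS univ)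
        = PS (Lo N (2 * g)) * Qc N M g * PS univ := by
      rw [← Matrix.mul_assoc, ← Matrix.mul_assoc, ← PS_comm_disj _ _ (Lo_Hi le_rfl),
        Matrix.mul_assoc (PS (Lo N (2 * g))), PS_Qc M _ g le_rfl (by omega), ← Matrix.mul_assoc,
        Matrix.mul_assoc _ (PS (Hi N (2 * g))), PS_mul_PS (subset_univ _)]
    have c2 : T2 N g M * PS (Lo N (2 * g)) = PS (Lo N (2 * g)) * T2 N g M := by
      rw [PS_T2 _ g (by omega)]
      · rw [mem_Lo, sl_val (by omega)]; omega
      · rw [mem_Lo, sl_val (by omega)]; omega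
    rw [Matrix.mul_assoc _ (PS (Hi N (2 * g))), c1]
    calc PS (Lo N (2 * g + 2)) * T2 N g M * (PS (Lo N (2 * g)) * Qc N M g * PS univ)
        = PS (Lo N (2 * g + 2)) * (T2 N g M * PS (Lo N (2 * g))) * (Qc N M g * PS univ) := by
          simp only [Matrix.mul_assoc]
      _ = (PS (Lo N (2 * g + 2)) * PS (Lo N (2 * g))) * (T2 N g M * (Qc N M g * PS univ)) := by
          rw [c2]; simp only [Matrix.mul_assoc]
      _ = _ := by
          rw [PS_mul_PS' (Lo_mono (by omega))]
          simp only [Matrix.mul_assoc]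
          rfl

lemma Rc_norm (M : α × α → α × α → ℝ) (b : ℕ → ℝ) : ∀ g, (∀ h < g, ‖Xc N M h‖ ≤ b h) →
    ‖Rc N M g‖ ≤ ∏ h ∈ range g, b h := by
  intro g
  induction g with
  | zero => intro _; simpa [Rc] using PS_norm _
  | succ g ih =>
    intro hb
    have h1 := ih fun h hh => hb h (by omega)
    have h2 := hb g (by omega)
    rw [prod_range_succ, mul_comm]
    simp only [Rc]
    exact (norm_mul_le _ _).trans (mul_le_mul h2 h1 (norm_nonneg _) ((norm_nonneg _).trans h2))

lemma Qc_apply (M : α × α → α × α → ℝ) : ∀ g, 2 * g ≤ N → ∀ x y : Fin N → α,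
    Qc N M g x y = if (∀ s : Fin N, 2 * g ≤ (s : ℕ) → x s = y s) then
      ∏ h ∈ range g, M (x (sl N (2 * h)), x (sl N (2 * h + 1)))
        (y (sl N (2 * h)), y (sl N (2 * h + 1))) else 0 := by
  intro g
  induction g with
  | zero =>
    intro _ x y
    simp [Qc, Matrix.one_apply, funext_iff]
  | succ g ih =>
    intro hg x y
    have ih := ih (by omega)
    simp only [Qc, Matrix.mul_apply]
    set z0 : Fin N → α := fun s => if (s : ℕ) < 2 * g then x s else y s with hz0
    rw [Finset.sum_eq_single z0]
    · rw [ih, if_pos (by intro s hs; simp [hz0, not_lt.2 hs])]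
      have v0 : ((sl N (2 * g) : Fin N) : ℕ) = 2 * g := sl_val (by omega)
      have v1 : ((sl N (2 * g + 1) : Fin N) : ℕ) = 2 * g + 1 := sl_val (by omega)
      have ep : ∏ h ∈ range g, M (z0 (sl N (2 * h)), z0 (sl N (2 * h + 1)))
          (y (sl N (2 * h)), y (sl N (2 * h + 1)))
          = ∏ h ∈ range g, M (x (sl N (2 * h)), x (sl N (2 * h + 1)))
          (y (sl N (2 * h)), y (sl N (2 * h + 1))) := by
        refine Finset.prod_congr rfl fun h hh => ?_
        rw [mem_range] at hh
        have w0 : ((sl N (2 * h) : Fin N) : ℕ) = 2 * h := sl_val (by omega)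
        have w1 : ((sl N (2 * h + 1) : Fin N) : ℕ) = 2 * h + 1 := sl_val (by omega)
        simp only [hz0, w0, w1]
        rw [if_pos (by omega), if_pos (by omega)]
      rw [ep]
      have e0 : z0 (sl N (2 * g)) = y (sl N (2 * g)) := by simp only [hz0, v0]; simp
      have e1 : z0 (sl N (2 * g + 1)) = y (sl N (2 * g + 1)) := by
        simp only [hz0, v1]; rw [if_neg (by omega)]
      unfold T2
      rw [e0, e1, prod_range_succ]
      have cnd : (∀ s : Fin N, ¬ ((s : ℕ) = 2 * g ∨ (s : ℕ) = 2 * g + 1) → x s = z0 s) ↔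
          (∀ s : Fin N, 2 * (g + 1) ≤ (s : ℕ) → x s = y s) := by
        constructor
        · intro h s hs
          have := h s (by omega)
          simp only [hz0] at this
          rwa [if_neg (by omega)] at this
        · intro h s hs
          simp only [hz0]
          split_ifs with hlt
          · rfl
          · exact h s (by omega)
      rw [if_congr cnd rfl rfl]
      split_ifs <;> ring
    · intro z _ hz
      rw [ih]
      unfold T2
      by_cases c1 : (∀ s : Fin N, ¬ ((s : ℕ) = 2 * g ∨ (s : ℕ) = 2 * g + 1) → x s = z s)
      · by_cases c2 : (∀ s : Fin N, 2 * g ≤ (s : ℕ) → z s = y s)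
        · exfalso
          apply hz
          funext s
          simp only [hz0]
          split_ifs with hlt
          · exact (c1 s (by omega)).symm
          · exact c2 s (by omega)
        · rw [if_neg c2, mul_zero]
      · rw [if_neg c1, zero_mul]
    · simp

lemma GS_univ {τ : Type*} [Fintype τ] [DecidableEq τ] : GS (univ : Finset τ) = univ := by
  ext π; simp [mem_GS]

lemma sym_apply {τ : Type*} [Fintype τ] [DecidableEq τ] (M : Matrix (τ → α) (τ → α) ℝ)
    (x y : τ → α) : (PS univ * M * PS univ : Matrix (τ → α) (τ → α) ℝ) x y
      = ((Nat.factorial (Fintype.card τ) : ℝ))⁻¹ ^ 2 *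
    ∑ π : Equiv.Perm τ, ∑ σ : Equiv.Perm τ, M (fun t => x (π t)) (fun t => y (σ t)) := by
  unfold PS
  rw [GS_univ, card_univ, Fintype.card_perm]
  simp only [Matrix.smul_mul, Matrix.mul_smul, smul_smul, Finset.sum_mul, Finset.mul_sum,
    Matrix.smul_apply, Matrix.sum_apply, smul_eq_mul]
  rw [Finset.sum_comm]
  refine Finset.sum_congr rfl fun π _ => ?_
  rw [← Equiv.sum_comp (Equiv.inv _)]
  refine Finset.sum_congr rfl fun σ _ => ?_
  have := mul_PM_apply (Equiv.inv _ σ) (PM π * M) x (y ∘ σ)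
  have e : (y ∘ σ) ∘ (Equiv.inv (Equiv.Perm τ) σ) = y := by funext t; simp
  rw [e, PM_mul_apply] at this
  rw [this, sq, mul_assoc]
  rfl

lemma T2_tensor (g : ℕ) (hg : 2 * g + 1 < N) (F F' : Matrix α α ℝ) :
    T2 N g (fun u v => F u.1 v.1 * F' u.2 v.2) = op (sl N (2 * g + 1)) F' * op (sl N (2 * g)) F := by
  have v0 : ((sl N (2 * g) : Fin N) : ℕ) = 2 * g := sl_val (by omega)
  have v1 : ((sl N (2 * g + 1) : Fin N) : ℕ) = 2 * g + 1 := sl_val (by omega)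
  have ne : sl N (2 * g) ≠ sl N (2 * g + 1) := by
    intro h; rw [Fin.ext_iff, v0, v1] at h; omega
  ext x y
  rw [Matrix.mul_apply]
  set z0 : Fin N → α := Function.update x (sl N (2 * g + 1)) (y (sl N (2 * g + 1))) with hz0
  have e1 : z0 (sl N (2 * g + 1)) = y (sl N (2 * g + 1)) := by simp [hz0]
  have e0 : z0 (sl N (2 * g)) = x (sl N (2 * g)) := by simp [hz0, ne]
  rw [Finset.sum_eq_single z0]
  · simp only [op, T2]
    have p1 : ∀ s, s ≠ sl N (2 * g + 1) → x s = z0 s := by intro s hs; simp [hz0, hs]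
    rw [if_pos p1, e0, e1]
    have cnd : (∀ s : Fin N, ¬ ((s : ℕ) = 2 * g ∨ (s : ℕ) = 2 * g + 1) → x s = y s) ↔
        (∀ s, s ≠ sl N (2 * g) → z0 s = y s) := by
      constructor
      · intro h s hs
        by_cases hs' : s = sl N (2 * g + 1)
        · rw [hs', e1]
        · have : z0 s = x s := by simp [hz0, hs']
          rw [this]
          refine h s ?_
          rintro (q | q)
          · exact hs (Fin.ext (by rw [q, v0]))
          · exact hs' (Fin.ext (by rw [q, v1]))
      · intro h s hs
        have h1 : s ≠ sl N (2 * g) := fun h' => hs (Or.inl (by rw [h', v0]))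
        have h2 : s ≠ sl N (2 * g + 1) := fun h' => hs (Or.inr (by rw [h', v1]))
        have : z0 s = x s := by simp [hz0, h2]
        rw [← this]; exact h s h1
    rw [if_congr cnd rfl rfl]
    split_ifs
    · ring
    · simp
  · intro z _ hz
    unfold op
    by_cases c1 : (∀ s, s ≠ sl N (2 * g + 1) → x s = z s)
    · by_cases c2 : (∀ s, s ≠ sl N (2 * g) → z s = y s)
      · exfalso; apply hz
        funext s
        by_cases hs : s = sl N (2 * g + 1)
        · rw [hs, e1, c2 _ (Ne.symm ne)]
        · rw [← c1 s hs]; simp [hz0, hs]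
      · rw [if_neg c2, mul_zero]
    · rw [if_neg c1, zero_mul]
  · simp

lemma T2_add (g : ℕ) (M M' : α × α → α × α → ℝ) :
    T2 N g (fun u v => M u v + M' u v) = T2 N g M + T2 N g M' := by
  ext x y; simp only [T2, Matrix.add_apply]; split_ifs <;> simp

lemma T2_smul (g : ℕ) (c : ℝ) (M : α × α → α × α → ℝ) :
    T2 N g (fun u v => c * M u v) = c • T2 N g M := by
  ext x y; simp only [T2, Matrix.smul_apply]; split_ifs <;> simp

lemma T2_sum {ι : Type*} (s : Finset ι) (g : ℕ) (M : ι → α × α → α × α → ℝ) :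
    T2 N g (fun u v => ∑ i ∈ s, M i u v) = ∑ i ∈ s, T2 N g (M i) := by
  ext x y; simp only [T2, Matrix.sum_apply]; split_ifs <;> simp

lemma factor (g : ℕ) (hg : 2 * g + 1 < N) (F F' : Matrix α α ℝ) :
    PS (Lo N (2 * g + 2)) * T2 N g (fun u v => F u.1 v.1 * F' u.2 v.2) * PS (Hi N (2 * g))
      = (PS (Lo N (2 * g + 2)) * op (sl N (2 * g + 1)) F' * PS (Hi N (2 * g + 1))) *
        (PS (Lo N (2 * g + 1)) * op (sl N (2 * g)) F * PS (Hi N (2 * g))) := by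
  have v0 : ((sl N (2 * g) : Fin N) : ℕ) = 2 * g := sl_val (by omega)
  have v1 : ((sl N (2 * g + 1) : Fin N) : ℕ) = 2 * g + 1 := sl_val (by omega)
  rw [T2_tensor g hg]
  set P2 : Matrix (Fin N → α) (Fin N → α) ℝ := PS (Lo N (2 * g + 2))
  set O1 : Matrix (Fin N → α) (Fin N → α) ℝ := op (sl N (2 * g + 1)) F'
  set O0 : Matrix (Fin N → α) (Fin N → α) ℝ := op (sl N (2 * g)) F
  set H1 : Matrix (Fin N → α) (Fin N → α) ℝ := PS (Hi N (2 * g + 1))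
  set P1 : Matrix (Fin N → α) (Fin N → α) ℝ := PS (Lo N (2 * g + 1))
  set H0 : Matrix (Fin N → α) (Fin N → α) ℝ := PS (Hi N (2 * g))
  have c1 : H1 * P1 = P1 * H1 := (PS_comm_disj _ _ (Lo_Hi le_rfl)).symm
  have c2 : H1 * O0 = O0 * H1 := PS_op _ _ (by rw [mem_Hi, v0]; omega) _
  have c3 : H1 * H0 = H0 := PS_mul_PS (Hi_mono (by omega))
  have c4 : P1 * O1 = O1 * P1 := PS_op _ _ (by rw [mem_Lo, v1]; omega) _
  have c5 : P2 * P1 = P2 := PS_mul_PS' (Lo_mono (by omega))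
  symm
  calc P2 * O1 * H1 * (P1 * O0 * H0) = P2 * O1 * (H1 * P1) * O0 * H0 := by
        simp only [Matrix.mul_assoc]
    _ = P2 * (O1 * P1) * (H1 * O0) * H0 := by rw [c1]; simp only [Matrix.mul_assoc]
    _ = (P2 * P1) * O1 * O0 * (H1 * H0) := by rw [c2, ← c4]; simp only [Matrix.mul_assoc]
    _ = _ := by rw [c3, c5]; simp only [Matrix.mul_assoc]

lemma T2_swap_norm (g : ℕ) (hg : 2 * g + 1 < N) (r : α × α → ℝ) (c : ℝ) (hc : 0 ≤ c)
    (hr : ∀ u, |r u| ≤ c) :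
    ‖T2 N g (fun u v => if v = (u.2, u.1) then r u else 0)‖ ≤ c := by
  have v0 : ((sl N (2 * g) : Fin N) : ℕ) = 2 * g := sl_val (by omega)
  have v1 : ((sl N (2 * g + 1) : Fin N) : ℕ) = 2 * g + 1 := sl_val (by omega)
  have ne : sl N (2 * g) ≠ sl N (2 * g + 1) := by
    intro h; rw [Fin.ext_iff, v0, v1] at h; omega
  set π := Equiv.swap (sl N (2 * g)) (sl N (2 * g + 1)) with hπ
  have hE : ∀ x y : Fin N → α, T2 N g (fun u v => if v = (u.2, u.1) then r u else 0) x y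
      = if y = x ∘ π then r (x (sl N (2 * g)), x (sl N (2 * g + 1))) else 0 := by
    intro x y
    unfold T2
    rw [← ite_and]
    congr 1
    apply propext
    simp only [Prod.mk.injEq]
    constructor
    · rintro ⟨h, h0, h1⟩
      funext s
      simp only [Function.comp_apply, hπ, Equiv.swap_apply_def]
      split_ifs with a b
      · rw [a, h0]
      · rw [b, h1]
      · refine (h s ?_).symm
        rintro (q | q)
        · exact a (Fin.ext (by rw [q, v0]))
        · exact b (Fin.ext (by rw [q, v1]))
    · rintro rfl
      refine ⟨fun s hs => ?_, by simp [hπ], by simp [hπ]⟩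
      simp only [Function.comp_apply, hπ]
      rw [Equiv.swap_apply_of_ne_of_ne]
      · rintro rfl; exact hs (Or.inl v0)
      · rintro rfl; exact hs (Or.inr v1)
  refine norm_le_of_nsq _ c hc fun w => ?_
  have h1 : ∀ x, (T2 N g (fun u v => if v = (u.2, u.1) then r u else 0) *ᵥ w) x
      = r (x (sl N (2 * g)), x (sl N (2 * g + 1))) * w (x ∘ π) := by
    intro x
    simp only [mulVec, dotProduct, hE]
    simp
  unfold nsq dotProduct
  simp only [h1]
  have h2 : ∑ x : Fin N → α, w x * w x = ∑ x : Fin N → α, w (x ∘ π) * w (x ∘ π) := by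
    rw [← Equiv.sum_comp (Equiv.arrowCongr π.symm (Equiv.refl α))]
    refine Finset.sum_congr rfl fun x _ => ?_
    have : (Equiv.arrowCongr π.symm (Equiv.refl α)) x = x ∘ π := by
      funext s; simp [Equiv.arrowCongr]
    rw [this]
  rw [h2, Finset.mul_sum]
  refine Finset.sum_le_sum fun x _ => ?_
  have h3 : r (x (sl N (2 * g)), x (sl N (2 * g + 1))) ^ 2 ≤ c ^ 2 := by
    rw [← sq_abs]; exact pow_le_pow_left₀ (abs_nonneg _) (hr _) 2
  nlinarith [mul_self_nonneg (w (x ∘ π))]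
end
end KB

set_option linter.unusedSectionVars false
namespace KB
open Finset Matrix
open scoped Matrix.Norms.L2Operator

lemma idx_inj {n : ℕ} {a b : Fin n × (Fin n × Fin n)}
    (h : (![a.1, a.2.1, a.2.2] : Fin 3 → Fin n) = ![b.1, b.2.1, b.2.2]) : a = b := by
  have h0 := congrFun h 0
  have h1 := congrFun h 1
  have h2 := congrFun h 2
  simp at h0 h1 h2
  ext <;> simp [h0, h1, h2]

/-- the sign variables of the random tensor -/
def sg (n : ℕ) : Signs ((Fin 3 → Fin n) → Bool) (Fin n × (Fin n × Fin n)) where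
  x a ω := signT ω ![a.1, a.2.1, a.2.2]
  f a := flipAt ![a.1, a.2.1, a.2.2]
  hx a ω := by
    simp only [signT]
    rw [flipAt_same]
    cases ω ![a.1, a.2.1, a.2.2] <;> simp
  hx' a b h ω := by
    simp only [signT]
    rw [flipAt_ne]
    intro h'
    exact h (idx_inj h').symm
  hb a ω := by
    simp only [signT]
    split_ifs <;> simp

/-- unordered label -/
def lab2 {n : ℕ} (a : Fin n × Fin n) : Sym2 (Fin n) := s(a.1, a.2)

lemma lab2_fiber {n : ℕ} (a : Fin n × Fin n) :
    (univ.filter fun b : Fin n × Fin n => lab2 a = lab2 b).card ≤ 2 := by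
  have : (univ.filter fun b : Fin n × Fin n => lab2 a = lab2 b) ⊆ {a, (a.2, a.1)} := by
    intro b hb
    simp only [mem_filter, mem_univ, true_and, lab2, Sym2.eq_iff] at hb
    simp only [mem_insert, mem_singleton, Prod.ext_iff]
    rcases hb with ⟨h1, h2⟩ | ⟨h1, h2⟩
    · left; exact ⟨h1.symm, h2.symm⟩
    · right; exact ⟨h2.symm, h1.symm⟩
  exact (Finset.card_le_card this).trans Finset.card_le_two

lemma Fm_sum {n : ℕ} (h : Fin n × Fin n → ℝ) (i j : Fin n) :
    ∑ a, h a * Fm a i j = (h (i, j) + h (j, i)) / 2 := by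
  have e : ∀ a : Fin n × Fin n, h a * Fm a i j
      = (if a = (i, j) then h a / 2 else 0) + (if a = (j, i) then h a / 2 else 0) := by
    intro a
    have h1 : (a.1 = i ∧ a.2 = j) ↔ a = (i, j) := by rw [Prod.ext_iff]
    have h2 : (a.2 = i ∧ a.1 = j) ↔ a = (j, i) := by rw [Prod.ext_iff]; tauto
    simp only [Fm, Matrix.smul_apply, Matrix.add_apply, Matrix.single_apply, smul_eq_mul, h1, h2]
    split_ifs <;> ring
  simp only [e, Finset.sum_add_distrib, Finset.sum_ite_eq', mem_univ, if_true]
  ring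

/-- symmetrized slice entry -/
noncomputable def tl {n : ℕ} (A : (Fin 3 → Fin n) → ℝ) (l i j : Fin n) : ℝ :=
  (A ![l, i, j] + A ![l, j, i]) / 2

/-- weights of the partial swap part -/
noncomputable def rw2 {n : ℕ} (A : (Fin 3 → Fin n) → ℝ) (u : Fin n × Fin n) : ℝ :=
  if u.1 = u.2 then 0 else ∑ l, tl A l u.1 u.2 * tl A l u.1 u.2

lemma Tmat_decomp {n : ℕ} (ω : (Fin 3 → Fin n) → Bool) (u v : Fin n × Fin n) :
    Tmat n (signT ω) u v = (∑ l : Fin n, ∑ a, ∑ b, (if lab2 a = lab2 b then 0 else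
      (bi true * (sg n).x (l, a) ω) * (bi true * (sg n).x (l, b) ω)) *
        (Fm b u.1 v.1 * Fm a u.2 v.2)) + (if v = (u.2, u.1) then rw2 (signT ω) u else 0) := by
  have hl : ∀ i j : Fin n, lab2 (j, i) = lab2 (i, j) := by
    intro i j; simp [lab2, Sym2.eq_swap]
  have h1 : ∀ l : Fin n, ∑ a, ∑ b, (if lab2 a = lab2 b then 0 else
      (bi true * (sg n).x (l, a) ω) * (bi true * (sg n).x (l, b) ω)) *
        (Fm b u.1 v.1 * Fm a u.2 v.2) = if lab2 (u.2, v.2) = lab2 (u.1, v.1) then 0 else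
          tl (signT ω) l u.1 v.1 * tl (signT ω) l u.2 v.2 := by
    intro l
    have e1 : ∀ a, ∑ b, (if lab2 a = lab2 b then 0 else
      (bi true * (sg n).x (l, a) ω) * (bi true * (sg n).x (l, b) ω)) *
        (Fm b u.1 v.1 * Fm a u.2 v.2) = (if lab2 a = lab2 (u.1, v.1) then 0 else
          (sg n).x (l, a) ω * tl (signT ω) l u.1 v.1) * Fm a u.2 v.2 := by
      intro a
      have : ∀ b, (if lab2 a = lab2 b then 0 else
          (bi true * (sg n).x (l, a) ω) * (bi true * (sg n).x (l, b) ω)) *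
        (Fm b u.1 v.1 * Fm a u.2 v.2) = ((if lab2 a = lab2 b then 0 else
          (sg n).x (l, a) ω * (sg n).x (l, b) ω) * Fm b u.1 v.1) * Fm a u.2 v.2 := by
        intro b; simp only [bi, if_true, one_mul]; ring
      simp only [this]
      rw [← Finset.sum_mul, Fm_sum, hl u.1 v.1]
      congr 1
      split_ifs
      · simp
      · simp only [tl, sg]; ring
    simp only [e1]
    rw [Fm_sum, hl u.2 v.2]
    split_ifs
    · simp
    · simp only [tl, sg]; ring
  simp only [h1]
  have hc : ∀ u v, calT n (signT ω) u v = ∑ l, tl (signT ω) l u.1 v.1 * tl (signT ω) l u.2 v.2 :=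
    fun _ _ => rfl
  unfold Tmat
  rw [hc]
  have hs : (lab2 (u.2, v.2) = lab2 (u.1, v.1)) ↔ (u.1 = u.2 ∧ v.1 = v.2) ∨ v = (u.2, u.1) := by
    simp only [lab2, Sym2.eq_iff, Prod.ext_iff]
    constructor
    · rintro (⟨a, b⟩ | ⟨a, b⟩)
      · left; exact ⟨a.symm, b.symm⟩
      · right; exact ⟨a.symm, b⟩
    · rintro (⟨a, b⟩ | ⟨a, b⟩)
      · left; exact ⟨a.symm, b.symm⟩
      · right; exact ⟨a.symm, b⟩
  by_cases E1 : u.1 = u.2 ∧ v.1 = v.2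
  · have : lab2 (u.2, v.2) = lab2 (u.1, v.1) := hs.2 (Or.inl E1)
    simp [this, E1, rw2]
  · by_cases E2 : v = (u.2, u.1)
    · have h' : lab2 (u.2, v.2) = lab2 (u.1, v.1) := hs.2 (Or.inr E2)
      have ne : u.1 ≠ u.2 := by
        intro h; apply E1; rw [E2]; exact ⟨h, h.symm⟩
      rw [if_neg E1]
      simp only [h', if_true, Finset.sum_const_zero, zero_add, sub_zero]
      rw [if_pos E2, rw2, if_neg ne]
      refine Finset.sum_congr rfl fun l _ => ?_
      rw [E2]
      simp only [tl]; ring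
    · have h' : ¬ (lab2 (u.2, v.2) = lab2 (u.1, v.1)) := by rw [hs]; tauto
      simp [h', E1, E2]

lemma tl_le {n : ℕ} (ω : (Fin 3 → Fin n) → Bool) (l i j : Fin n) :
    tl (signT ω) l i j * tl (signT ω) l i j ≤ 1 := by
  unfold tl signT
  split_ifs <;> norm_num

lemma rw2_le {n : ℕ} (ω : (Fin 3 → Fin n) → Bool) (u : Fin n × Fin n) :
    |rw2 (signT ω) u| ≤ n := by
  unfold rw2
  split_ifs
  · simp
  · rw [abs_of_nonneg (Finset.sum_nonneg fun l _ => mul_self_nonneg _)]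
    calc _ ≤ ∑ l : Fin n, (1:ℝ) := Finset.sum_le_sum fun l _ => tl_le ω l _ _
      _ = n := by simp

/-- random chaos of the `g`-th pair -/
noncomputable def Wg (n N : ℕ) [NeZero N] (g : ℕ) (ω : (Fin 3 → Fin n) → Bool) :
    Matrix (Fin N → Fin n) (Fin N → Fin n) ℝ :=
  offC (sg n) lab2 (Kf (Lo N (2 * g + 2)) (Hi N (2 * g + 1)) (sl N (2 * g + 1)))
    (Kf (Lo N (2 * g + 1)) (Hi N (2 * g)) (sl N (2 * g))) (fun _ => true) ω

lemma Xc_decomp {n N : ℕ} [NeZero N] (g : ℕ) (hg : 2 * g + 1 < N) (ω : (Fin 3 → Fin n) → Bool) :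
    Xc N (Tmat n (signT ω)) g = Wg n N g ω + PS (Lo N (2 * g + 2)) *
      T2 N g (fun u v => if v = (u.2, u.1) then rw2 (signT ω) u else 0) * PS (Hi N (2 * g)) := by
  have e : Tmat n (signT ω) = fun u v => (∑ l : Fin n, ∑ a, ∑ b, (if lab2 a = lab2 b then 0 else
      (bi true * (sg n).x (l, a) ω) * (bi true * (sg n).x (l, b) ω)) *
        (Fm b u.1 v.1 * Fm a u.2 v.2)) + (if v = (u.2, u.1) then rw2 (signT ω) u else 0) := by
    funext u v; exact Tmat_decomp ω u v
  unfold Xc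
  rw [e, T2_add, Matrix.mul_add, Matrix.add_mul]
  congr 1
  unfold Wg offC
  simp only [T2_sum, T2_smul, Finset.mul_sum, Finset.sum_mul, Matrix.mul_smul, Matrix.smul_mul]
  refine Finset.sum_congr rfl fun l _ => Finset.sum_congr rfl fun a _ =>
    Finset.sum_congr rfl fun b _ => ?_
  congr 1
  exact factor g hg (Fm b) (Fm a)

lemma Xc_norm {n N : ℕ} [NeZero N] (g : ℕ) (hg : 2 * g + 1 < N) (ω : (Fin 3 → Fin n) → Bool) :
    ‖Xc N (Tmat n (signT ω)) g‖ ≤ n + ‖Wg n N g ω‖ := by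
  rw [Xc_decomp g hg, add_comm (n : ℝ)]
  refine (norm_add_le _ _).trans (add_le_add le_rfl ?_)
  have h1 := T2_swap_norm g hg (rw2 (signT ω)) n (by positivity) (rw2_le ω)
  calc _ ≤ ‖(PS (Lo N (2 * g + 2)) : Matrix (Fin N → Fin n) (Fin N → Fin n) ℝ)‖ *
      ‖T2 N g (fun u v => if v = (u.2, u.1) then rw2 (signT ω) u else 0)‖ *
      ‖(PS (Hi N (2 * g)) : Matrix (Fin N → Fin n) (Fin N → Fin n) ℝ)‖ :=
        (norm_mul_le _ _).trans (mul_le_mul_of_nonneg_right (norm_mul_le _ _) (norm_nonneg _))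
    _ ≤ 1 * n * 1 := by
        refine mul_le_mul (mul_le_mul (PS_norm _) h1 (norm_nonneg _) zero_le_one) (PS_norm _)
          (norm_nonneg _) (by positivity)
    _ = n := by ring

lemma opNorm_le {ι : Type*} [Fintype ι] [DecidableEq ι] (M : Matrix ι ι ℝ) :
    opNorm (fun i j => M i j) ≤ ‖M‖ := by
  unfold opNorm
  refine Real.sSup_le ?_ (norm_nonneg _)
  rintro r ⟨u, v, hu, hv, rfl⟩
  have e : ∑ i, ∑ j, u i * M i j * v j = u.ofLp ⬝ᵥ (M *ᵥ v.ofLp) := by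
    simp only [dotProduct, mulVec, Finset.mul_sum, mul_assoc]
  have nu : nsq u.ofLp = 1 := by rw [nsq_eq_norm]; simp [hu]
  have nv : nsq v.ofLp = 1 := by rw [nsq_eq_norm]; simp [hv]
  rw [e]
  have h1 := dot_sq_le u.ofLp (M *ᵥ v.ofLp)
  have h2 := nsq_mulVec_le M v.ofLp
  rw [nv] at h2
  rw [nu] at h1
  exact abs_le_of_sq_le_sq (by linarith) (norm_nonneg _)

lemma Bmat_eq (n q : ℕ) [NeZero (q / 2)] (hq : q / 2 = 2 * (q / 4)) (A : (Fin 3 → Fin n) → ℝ)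
    (I J : Fin (q / 2) → Fin n) : Bmat n q A I J = Rc (q / 2) (Tmat n A) (q / 4) I J := by
  rw [Rc_eq _ _ hq.ge]
  have hL : Lo (q / 2) (2 * (q / 4)) = univ := by
    ext s; rw [mem_Lo]; simp only [mem_univ, iff_true]
    have := s.2; omega
  rw [hL, sym_apply, Fintype.card_fin]
  unfold Bmat
  congr 1
  refine Finset.sum_congr rfl fun π _ => Finset.sum_congr rfl fun σ _ => ?_
  rw [Qc_apply _ _ hq.ge, if_pos (by intro s hs; have := s.2; omega), Finset.prod_range]
  unfold bigA3
  refine Finset.prod_congr rfl fun g _ => ?_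
  have h0 : pairIdx q g 0 = sl (q / 2) (2 * g) := by
    apply Fin.ext
    have := g.2
    rw [sl_val (by omega)]; simp [pairIdx]
  have h1 : pairIdx q g 1 = sl (q / 2) (2 * g + 1) := by
    apply Fin.ext
    have := g.2
    rw [sl_val (by omega)]; simp [pairIdx]
  rw [h0, h1]

lemma opNorm_B_le (n q : ℕ) [NeZero (q / 2)] (hq : q / 2 = 2 * (q / 4))
    (ω : (Fin 3 → Fin n) → Bool) (b : ℕ → ℝ)
    (hb : ∀ g < q / 4, ‖Wg n (q / 2) g ω‖ ≤ b g) :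
    opNorm (fun I J : Fin (q / 2) → Fin n => Bmat n q (signT ω) I J)
      ≤ ∏ g ∈ range (q / 4), ((n : ℝ) + b g) := by
  simp only [Bmat_eq n q hq]
  refine (opNorm_le _).trans (Rc_norm _ _ _ fun g hg => ?_)
  exact (Xc_norm g (by omega) ω).trans (add_le_add le_rfl (hb g hg))

lemma opNorm_nonneg {ι : Type*} [Fintype ι] (M : ι → ι → ℝ) : 0 ≤ opNorm M := by
  unfold opNorm
  refine Real.sSup_nonneg ?_
  rintro r ⟨u, v, _, _, rfl⟩
  exact abs_nonneg _

/-- moment bound for one pair -/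
lemma Wg_mom (n m : ℕ) [NeZero (2 * m)] (hn : 0 < n) (hmn : 2 * m ≤ n) (g : ℕ) (hg : g < m) (p : ℕ)
    (hp : 1 ≤ p) (hpn : p ≤ n) :
    ∑ ω, ‖Wg n (2 * m) g ω‖ ^ (2 * p) ≤ 20 * ((n : ℝ) ^ (2 * m)) ^ 2 *
      (9216 * p * n * (2 * n * m / ((g + 1) * (m - g))) * (2 * n * m / ((g + 1) * (m - g)))) ^ p *
        Fintype.card ((Fin 3 → Fin n) → Bool) := by
  have : NeZero n := ⟨hn.ne'⟩
  set κ : ℝ := 2 * n * m / ((g + 1) * (m - g)) with hκ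
  have hm0 : (0:ℝ) < m := by exact_mod_cast (by omega : 0 < m)
  have hn0 : (0:ℝ) < n := by exact_mod_cast hn
  have hmg : (1:ℝ) ≤ m - g := by
    have : (g:ℝ) + 1 ≤ m := by exact_mod_cast hg
    linarith
  have hg0 : (0:ℝ) ≤ g := by positivity
  have hgm : (g:ℝ) + 1 ≤ m := by exact_mod_cast hg
  have hκ0 : 0 < κ := by rw [hκ]; positivity
  have key : ∀ k : ℕ, k ≤ n → ((g:ℝ) + 1 ≤ k ∨ (m:ℝ) - g ≤ k) → (n:ℝ) + k ≤ κ * k := by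
    intro k hk h
    have hk' : (k:ℝ) ≤ n := by exact_mod_cast hk
    have : 2 * (n:ℝ) ≤ κ * k := by
      rw [hκ, div_mul_eq_mul_div, le_div_iff₀ (by positivity)]
      rcases h with h | h
      · have : ((g:ℝ) + 1) * (m - g) ≤ k * m := mul_le_mul h (by linarith) (by linarith) (by positivity)
        nlinarith
      · have : (m - g) * ((g:ℝ) + 1) ≤ k * m := mul_le_mul h hgm (by linarith) (by positivity)
        nlinarith
    linarith
  have v0 : ((sl (2 * m) (2 * g) : Fin (2 * m)) : ℕ) = 2 * g := sl_val (by omega)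
  have v1 : ((sl (2 * m) (2 * g + 1) : Fin (2 * m)) : ℕ) = 2 * g + 1 := sl_val (by omega)
  have K1 : KB2 (Kf (α := Fin n) (Lo (2 * m) (2 * g + 2)) (Hi (2 * m) (2 * g + 1))
      (sl (2 * m) (2 * g + 1))) κ := by
    refine Kf_KB2 _ _ _ (by rw [mem_Lo, v1]; omega) (by rw [mem_Hi, v1]) κ hκ0.le ?_ ?_
    · rw [Lo_card (by omega), Fintype.card_fin]
      refine key _ (by omega) (Or.inl ?_)
      push_cast; linarith
    · rw [Hi_card (by omega), Fintype.card_fin]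
      refine key _ (by omega) (Or.inr ?_)
      rw [Nat.cast_sub (by omega)]
      push_cast; linarith
  have K0 : KB2 (Kf (α := Fin n) (Lo (2 * m) (2 * g + 1)) (Hi (2 * m) (2 * g))
      (sl (2 * m) (2 * g))) κ := by
    refine Kf_KB2 _ _ _ (by rw [mem_Lo, v0]; omega) (by rw [mem_Hi, v0]) κ hκ0.le ?_ ?_
    · rw [Lo_card (by omega), Fintype.card_fin]
      refine key _ (by omega) (Or.inl ?_)
      push_cast; linarith
    · rw [Hi_card (by omega), Fintype.card_fin]
      refine key _ (by omega) (Or.inr ?_)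
      rw [Nat.cast_sub (by omega)]
      push_cast; linarith
  have := X_thm (sg n) lab2 lab2_fiber _ _ κ κ hκ0 hκ0 K1 K0 p hp (by simpa using hpn)
    (fun _ => true)
  simp only [Fintype.card_fin, Fintype.card_pi_const] at this
  push_cast at this
  unfold Wg
  simpa using this
end KB

set_option linter.unusedSectionVars false
namespace KB
open Finset Matrix
open scoped Matrix.Norms.L2Operator

lemma markov_count {Ω : Type*} [Fintype Ω] (Y : Ω → ℝ) (hY : ∀ ω, 0 ≤ Y ω) (β : ℝ) (hβ : 0 ≤ β)
    (r : ℕ) : ((univ.filter fun ω => β < Y ω).card : ℝ) * β ^ r ≤ ∑ ω, Y ω ^ r := by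
  classical
  calc ((univ.filter fun ω => β < Y ω).card : ℝ) * β ^ r
      = ∑ ω ∈ univ.filter (fun ω => β < Y ω), β ^ r := by simp
    _ ≤ ∑ ω ∈ univ.filter (fun ω => β < Y ω), Y ω ^ r := by
        refine sum_le_sum fun ω hω => ?_
        exact pow_le_pow_left₀ hβ (mem_filter.1 hω).2.le r
    _ ≤ ∑ ω, Y ω ^ r := by
        refine sum_le_sum_of_subset_of_nonneg (filter_subset _ _) fun ω _ _ => pow_nonneg (hY ω) r

/-- kernel parameter -/
noncomputable def kap (n m g : ℕ) : ℝ := 2 * n * m / ((g + 1) * (m - g))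

/-- threshold -/
noncomputable def bet (n m p g : ℕ) : ℝ := Real.sqrt (Real.exp 9 * 9216 * (p * n)) * kap n m g

lemma kap_pos {n m g : ℕ} (hn : 0 < n) (hg : g < m) : 0 < kap n m g := by
  have hm0 : (0:ℝ) < m := by exact_mod_cast (by omega : 0 < m)
  have hn0 : (0:ℝ) < n := by exact_mod_cast hn
  have : (0:ℝ) < m - g := by
    have : (g:ℝ) < m := by exact_mod_cast hg
    linarith
  unfold kap
  positivity

lemma bad_count (n m : ℕ) [NeZero (2 * m)] (hn : 0 < n) (hmn : 2 * m ≤ n) (g : ℕ) (hg : g < m)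
    (p : ℕ) (hp : 1 ≤ p) (hpn : p ≤ n) (hpl : (m : ℝ) * Real.log n ≤ p) :
    ((univ.filter fun ω => bet n m p g < ‖Wg n (2 * m) g ω‖).card : ℝ) * (n : ℝ) ^ 5 ≤
      20 * Fintype.card ((Fin 3 → Fin n) → Bool) := by
  have hn0 : (0:ℝ) < n := by exact_mod_cast hn
  have hn1 : (1:ℝ) ≤ n := by exact_mod_cast hn
  have hp0 : (0:ℝ) < p := by exact_mod_cast hp
  have hκ := kap_pos hn hg
  have hβ : 0 ≤ bet n m p g := by unfold bet; positivity
  have h1 := (markov_count (fun ω => ‖Wg n (2 * m) g ω‖) (fun ω => norm_nonneg _) _ hβ (2 * p)).trans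
    (Wg_mom n m hn hmn g hg p hp hpn)
  set M : ℝ := 9216 * p * n * kap n m g * kap n m g with hM
  have hM0 : 0 < M := by positivity
  have h2 : bet n m p g ^ (2 * p) = Real.exp 9 ^ p * M ^ p := by
    rw [pow_mul, ← mul_pow]
    congr 1
    unfold bet
    rw [mul_pow, Real.sq_sqrt (by positivity), hM]
    ring
  change _ ≤ 20 * ((n : ℝ) ^ (2 * m)) ^ 2 * M ^ p * _ at h1
  rw [h2] at h1
  set c : ℝ := ((univ.filter fun ω => bet n m p g < ‖Wg n (2 * m) g ω‖).card : ℝ) with hc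
  have hc0 : 0 ≤ c := by positivity
  set O : ℝ := (Fintype.card ((Fin 3 → Fin n) → Bool) : ℝ) with hO
  have h3 : c * Real.exp 9 ^ p ≤ 20 * ((n : ℝ) ^ (2 * m)) ^ 2 * O := by
    have : M ^ p * (c * Real.exp 9 ^ p) ≤ M ^ p * (20 * ((n : ℝ) ^ (2 * m)) ^ 2 * O) := by
      linarith
    exact le_of_mul_le_mul_left this (by positivity)
  have h4 : (n : ℝ) ^ (9 * m) ≤ Real.exp 9 ^ p := by
    rw [← Real.exp_nat_mul]
    have : (n : ℝ) ^ (9 * m) = Real.exp ((9 * m : ℕ) * Real.log n) := by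
      rw [Real.exp_nat_mul, Real.exp_log hn0]
    rw [this, Real.exp_le_exp]
    push_cast
    nlinarith
  have h5 : c * ((n:ℝ) ^ (5 * m)) ≤ 20 * O := by
    have h6 : (n:ℝ) ^ (9 * m) = ((n : ℝ) ^ (2 * m)) ^ 2 * (n:ℝ) ^ (5 * m) := by
      rw [← pow_mul, ← pow_add]; congr 1; omega
    have : ((n : ℝ) ^ (2 * m)) ^ 2 * (c * ((n:ℝ) ^ (5 * m))) ≤ ((n : ℝ) ^ (2 * m)) ^ 2 * (20 * O) := by
      have := mul_le_mul_of_nonneg_left h4 hc0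
      rw [h6] at this
      linarith
    exact le_of_mul_le_mul_left this (by positivity)
  refine le_trans ?_ h5
  refine mul_le_mul_of_nonneg_left (pow_le_pow_right₀ hn1 (by omega)) hc0

lemma union_count (n m : ℕ) [NeZero (2 * m)] (hn : 3 ≤ n) (hmn : 2 * m ≤ n)
    (p : ℕ) (hp : 1 ≤ p) (hpn : p ≤ n) (hpl : (m : ℝ) * Real.log n ≤ p) :
    ((univ.filter fun ω => ¬ ∀ g < m, ‖Wg n (2 * m) g ω‖ ≤ bet n m p g).card : ℝ) * n ≤
      Fintype.card ((Fin 3 → Fin n) → Bool) := by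
  classical
  have hsub : (univ.filter fun ω => ¬ ∀ g < m, ‖Wg n (2 * m) g ω‖ ≤ bet n m p g) ⊆
      (range m).biUnion fun g => univ.filter fun ω => bet n m p g < ‖Wg n (2 * m) g ω‖ := by
    intro ω hω
    simp only [mem_filter, mem_univ, true_and, not_forall, not_le] at hω
    obtain ⟨g, hg, h⟩ := hω
    simp only [mem_biUnion, mem_range, mem_filter, mem_univ, true_and]
    exact ⟨g, hg, h⟩
  have h1 : ((univ.filter fun ω => ¬ ∀ g < m, ‖Wg n (2 * m) g ω‖ ≤ bet n m p g).card : ℝ) ≤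
      ∑ g ∈ range m, ((univ.filter fun ω => bet n m p g < ‖Wg n (2 * m) g ω‖).card : ℝ) := by
    exact_mod_cast (card_le_card hsub).trans card_biUnion_le
  have h2 : (∑ g ∈ range m, ((univ.filter fun ω => bet n m p g < ‖Wg n (2 * m) g ω‖).card : ℝ)) *
      (n:ℝ) ^ 5 ≤ m * (20 * Fintype.card ((Fin 3 → Fin n) → Bool)) := by
    rw [sum_mul]
    refine (sum_le_sum fun g hg => bad_count n m (by omega) hmn g (mem_range.1 hg) p hp hpn hpl).trans ?_
    simp
  set c : ℝ := ((univ.filter fun ω => ¬ ∀ g < m, ‖Wg n (2 * m) g ω‖ ≤ bet n m p g).card : ℝ)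
  have hc0 : 0 ≤ c := by positivity
  set O : ℝ := (Fintype.card ((Fin 3 → Fin n) → Bool) : ℝ) with hO
  have hO0 : 0 ≤ O := by positivity
  have hn3 : (3:ℝ) ≤ n := by exact_mod_cast hn
  have hm : 2 * (m:ℝ) ≤ n := by exact_mod_cast hmn
  have h3 : c * (n:ℝ) ^ 5 ≤ m * (20 * O) :=
    (mul_le_mul_of_nonneg_right h1 (by positivity)).trans h2
  have h4 : (27:ℝ) ≤ (n:ℝ) ^ 3 := by
    have := pow_le_pow_left₀ (by norm_num) hn3 3
    linarith
  have h5 : (n:ℝ) * (10 * (c * n)) ≤ n * (10 * O) := by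
    have e1 : c * (n:ℝ) ^ 5 = (c * n * n) * n ^ 3 := by ring
    have e2 : (c * n * n) * 27 ≤ (c * n * n) * (n:ℝ) ^ 3 :=
      mul_le_mul_of_nonneg_left h4 (by positivity)
    have e3 : 2 * (m:ℝ) * (10 * O) ≤ n * (10 * O) := mul_le_mul_of_nonneg_right hm (by positivity)
    have e4 : 0 ≤ c * n * n := by positivity
    nlinarith
  have := le_of_mul_le_mul_left h5 (by linarith)
  linarith

/-- absolute constant -/
noncomputable def Dc : ℝ := 1 + 2 * Real.sqrt (Real.exp 9 * 9216)

lemma Dc_pos : 1 ≤ Dc := by unfold Dc; linarith [Real.sqrt_nonneg (Real.exp 9 * 9216)]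

lemma prod_bound (n m p : ℕ) (hn : 0 < n) (hm : 0 < m) (hmp : m ≤ p) (hmn : m ≤ n) :
    ∏ g ∈ range m, ((n:ℝ) + bet n m p g) ≤
      (Dc * Real.exp 2 * (Real.sqrt (p * n) * n / m)) ^ m := by
  have hm0 : (0:ℝ) < m := by exact_mod_cast hm
  have hn0 : (0:ℝ) < n := by exact_mod_cast hn
  have hmp' : (m:ℝ) ≤ p := by exact_mod_cast hmp
  have hmn' : (m:ℝ) ≤ n := by exact_mod_cast hmn
  have hs : (m:ℝ) ≤ Real.sqrt (p * n) := by
    apply Real.le_sqrt_of_sq_le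
    nlinarith
  set S := Real.sqrt ((p:ℝ) * n) with hS
  have h1 : ∀ g ∈ range m, (n:ℝ) + bet n m p g ≤ Dc * (S * n * m) / ((g + 1) * (m - g)) := by
    intro g hg
    have hg' : (g:ℝ) + 1 ≤ m := by exact_mod_cast (mem_range.1 hg)
    have hgm : (0:ℝ) < m - g := by linarith
    have hg0 : (0:ℝ) ≤ g := by positivity
    have hsq : Real.sqrt (Real.exp 9 * 9216 * (p * n)) = Real.sqrt (Real.exp 9 * 9216) * S :=
      Real.sqrt_mul (by positivity) _
    unfold bet kap Dc
    rw [hsq, le_div_iff₀ (by positivity), add_mul]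
    set s := Real.sqrt (Real.exp 9 * 9216)
    have e1 : s * S * (2 * n * m / ((g + 1) * (m - g))) * ((g + 1) * (m - g)) = 2 * s * (S * n * m) := by
      field_simp
    rw [e1]
    have e2 : (n:ℝ) * ((g + 1) * (m - g)) ≤ S * n * m := by
      have : ((g:ℝ) + 1) * (m - g) ≤ m * S := mul_le_mul hg' (by linarith) hgm.le hm0.le
      nlinarith
    linarith
  have hpos : ∀ g ∈ range m, 0 ≤ (n:ℝ) + bet n m p g := by
    intro g hg
    have := kap_pos hn (mem_range.1 hg)
    unfold bet
    positivity
  refine (prod_le_prod hpos h1).trans ?_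
  rw [prod_div_distrib, prod_const, card_range, prod_mul_distrib]
  have f1 : ∏ g ∈ range m, ((g:ℝ) + 1) = (m.factorial : ℝ) := by
    rw [← prod_range_add_one_eq_factorial]; push_cast; rfl
  have f2 : ∏ g ∈ range m, ((m:ℝ) - g) = (m.factorial : ℝ) := by
    rw [← f1, ← prod_range_reflect]
    refine prod_congr rfl fun g hg => ?_
    have := mem_range.1 hg
    rw [Nat.sub_sub, Nat.cast_sub (by omega)]
    push_cast; ring
  rw [f1, f2]
  have f3 : (m:ℝ) ^ m ≤ Real.exp 1 ^ m * m.factorial := by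
    have h := Real.pow_div_factorial_le_exp (m:ℝ) hm0.le m
    rw [div_le_iff₀ (by positivity)] at h
    rwa [← Real.exp_nat_mul, mul_one]
  rw [div_le_iff₀ (by positivity)]
  have f4 : ((m:ℝ) ^ m) * ((m:ℝ) ^ m) ≤ Real.exp 2 ^ m * ((m.factorial : ℝ) * m.factorial) := by
    have := mul_le_mul f3 f3 (by positivity) (by positivity)
    have e : Real.exp 2 = Real.exp 1 * Real.exp 1 := by rw [← Real.exp_add]; norm_num
    rw [e, mul_pow]
    linarith
  have hD := Dc_pos
  have f5 : (Dc * (S * n * m)) ^ m = (Dc * (S * n / m)) ^ m * ((m:ℝ) ^ m * (m:ℝ) ^ m) := by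
    rw [← mul_pow, ← mul_pow]; congr 1; field_simp
  have f6 : (Dc * Real.exp 2 * (S * n / m)) ^ m = (Dc * (S * n / m)) ^ m * Real.exp 2 ^ m := by
    rw [← mul_pow]; congr 1; ring
  rw [f5, f6, mul_assoc]
  have : 0 ≤ Dc := by linarith
  exact mul_le_mul_of_nonneg_left f4 (by positivity)

lemma final_num (n m p : ℕ) (hn : 0 < n) (hm : 0 < m) (hp : (p:ℝ) ≤ 2 * m * Real.log n)
    (hl : 3 * Dc * Real.exp 2 + 1 ≤ Real.log n) :
    Dc * Real.exp 2 * (Real.sqrt (p * n) * n / m) ≤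
      (n : ℝ) ^ ((3 : ℝ) / 2) * Real.log n ^ 5 / Real.sqrt ((4 * m : ℕ) : ℝ) := by
  have hm0 : (0:ℝ) < m := by exact_mod_cast hm
  have hn0 : (0:ℝ) < n := by exact_mod_cast hn
  have hD := Dc_pos
  set L := Real.log n
  set K := Dc * Real.exp 2 with hK
  have hK0 : 0 < K := by positivity
  have hl' : 3 * K + 1 ≤ L := by rw [hK]; linarith
  have hL1 : 1 ≤ L := by linarith
  have h32 : (n:ℝ) ^ ((3:ℝ)/2) = Real.sqrt n * n := by
    rw [Real.sqrt_eq_rpow, ← Real.rpow_add_one hn0.ne']; norm_num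
  have hs4 : Real.sqrt ((4 * m : ℕ) : ℝ) = 2 * Real.sqrt m := by
    push_cast
    rw [Real.sqrt_mul (by norm_num), show (4:ℝ) = 2 ^ 2 by norm_num, Real.sqrt_sq (by norm_num)]
  have hsp : Real.sqrt (p * n) ≤ (3 / 2) * Real.sqrt m * L * Real.sqrt n := by
    rw [Real.sqrt_le_left (by positivity)]
    rw [mul_pow, mul_pow, mul_pow, Real.sq_sqrt hm0.le, Real.sq_sqrt hn0.le]
    refine mul_le_mul_of_nonneg_right ?_ hn0.le
    have : m * L ≤ m * L ^ 2 := mul_le_mul_of_nonneg_left (by nlinarith) hm0.le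
    have : 0 ≤ m * L := by positivity
    nlinarith
  rw [h32, hs4, le_div_iff₀ (by positivity)]
  have hmm : Real.sqrt m * Real.sqrt m = m := Real.mul_self_sqrt hm0.le
  have h5 : 3 * K * L ≤ L ^ 5 := by
    have a : 3 * K * L ≤ L ^ 2 := by nlinarith
    exact a.trans (pow_le_pow_right₀ hL1 (by norm_num))
  calc K * (Real.sqrt (p * n) * n / m) * (2 * Real.sqrt m)
      ≤ K * (((3 / 2) * Real.sqrt m * L * Real.sqrt n) * n / m) * (2 * Real.sqrt m) := by gcongr
    _ = 3 * K * L * (Real.sqrt n * n) * (Real.sqrt m * Real.sqrt m / m) := by ring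
    _ = 3 * K * L * (Real.sqrt n * n) := by rw [hmm, div_self hm0.ne', mul_one]
    _ ≤ L ^ 5 * (Real.sqrt n * n) := by gcongr
    _ = _ := by ring

lemma tprob_ge (n : ℕ) (hn : 0 < n) (P : ((Fin 3 → Fin n) → ℝ) → Prop)
    (G : ((Fin 3 → Fin n) → Bool) → Prop) (hG : ∀ ω, G ω → P (signT ω))
    [DecidablePred G]
    (h : ((univ.filter fun ω => ¬ G ω).card : ℝ) * n ≤ Fintype.card ((Fin 3 → Fin n) → Bool)) :
    1 - (n:ℝ) ^ (-(1:ℝ)) ≤ tprob n 3 P := by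
  classical
  have hn0 : (0:ℝ) < n := by exact_mod_cast hn
  unfold tprob
  rw [Real.rpow_neg_one, le_div_iff₀ (by positivity)]
  have h1 : Nat.card {A : (Fin 3 → Fin n) → Bool // P (signT A)} =
      (univ.filter fun A : (Fin 3 → Fin n) → Bool => P (signT A)).card := by
    rw [Nat.card_eq_fintype_card, Fintype.card_subtype]
  have h2 : (univ.filter G).card ≤ (univ.filter fun A : (Fin 3 → Fin n) → Bool => P (signT A)).card := by
    refine card_le_card fun ω hω => ?_
    simp only [mem_filter, mem_univ, true_and] at hω ⊢
    exact hG ω hω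
  have h3 : (univ.filter G).card + (univ.filter fun ω => ¬ G ω).card =
      Fintype.card ((Fin 3 → Fin n) → Bool) := by
    rw [card_filter_add_card_filter_not, card_univ]
  have h3' : ((univ.filter G).card : ℝ) + ((univ.filter fun ω => ¬ G ω).card : ℝ) =
      Fintype.card ((Fin 3 → Fin n) → Bool) := by exact_mod_cast h3
  have h2' : ((univ.filter G).card : ℝ) ≤
     ((univ.filter fun A : (Fin 3 → Fin n) → Bool => P (signT A)).card : ℝ) := by exact_mod_cast h2
  rw [h1]
  have h4 : ((univ.filter fun ω => ¬ G ω).card : ℝ) ≤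
      (n:ℝ)⁻¹ * Fintype.card ((Fin 3 → Fin n) → Bool) := by
    rw [inv_mul_eq_div, le_div_iff₀ hn0]; exact h
  linarith

lemma good_bound (n m q N : ℕ) (hq : q / 4 = m) (hN : q / 2 = N) (hNm : N = 2 * m)
    [NeZero N] (ω : (Fin 3 → Fin n) → Bool)
    (b : ℕ → ℝ) (hb : ∀ g < m, ‖Wg n N g ω‖ ≤ b g) :
    opNorm (fun I J : Fin (q/2) → Fin n => Bmat n q (signT ω) I J) ≤
      ∏ g ∈ range m, ((n:ℝ) + b g) := by
  subst hN
  subst hq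
  exact opNorm_B_le n q hNm ω b hb

lemma main17 : ∃ C c : ℝ, 0 < C ∧ 0 < c ∧
    ∀ (n q k : ℕ), C ≤ (n : ℝ) → q = 4 * 2 ^ k → (q : ℝ) * Real.log n ≤ (n : ℝ) →
      1 - (n : ℝ) ^ (-c) ≤
        tprob n 3 (fun A =>
          opNorm (fun I J : Fin (q / 2) → Fin n => Bmat n q A I J) ^ ((4 : ℝ) / (q : ℝ)) ≤
            (n : ℝ) ^ ((3 : ℝ) / 2) * Real.log n ^ 5 / Real.sqrt q) := by
  classical
  have hD := Dc_pos
  refine ⟨Real.exp (3 * Dc * Real.exp 2 + 1), 1, Real.exp_pos _, one_pos, ?_⟩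
  intro n q k hC hq hqn
  obtain ⟨m, hmk⟩ : ∃ m, m = 2 ^ k := ⟨_, rfl⟩
  have hm : 0 < m := by rw [hmk]; positivity
  rw [← hmk] at hq
  have hn0 : (0:ℝ) < n := (Real.exp_pos _).trans_le hC
  have hn : 0 < n := by exact_mod_cast hn0
  have hl : 3 * Dc * Real.exp 2 + 1 ≤ Real.log n := (Real.le_log_iff_exp_le hn0).2 hC
  have he2 : 1 ≤ Real.exp 2 := Real.one_le_exp (by norm_num)
  have hL4 : 4 ≤ Real.log n := by nlinarith
  have hm1 : (1:ℝ) ≤ m := by exact_mod_cast hm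
  have hq' : (q:ℝ) = 4 * m := by rw [hq]; push_cast; rfl
  rw [hq'] at hqn
  have hmL : (m:ℝ) ≤ m * Real.log n := by nlinarith
  have hnm : 16 * (m:ℝ) ≤ n := by nlinarith
  have hnm' : 16 * m ≤ n := by exact_mod_cast hnm
  set p := ⌈(m:ℝ) * Real.log n⌉₊ with hp
  have hp1 : (m:ℝ) * Real.log n ≤ p := Nat.le_ceil _
  have hp2 : (p:ℝ) < m * Real.log n + 1 := Nat.ceil_lt_add_one (by positivity)
  have hmp : m ≤ p := by exact_mod_cast hmL.trans hp1
  have hpn : p ≤ n := by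
    have : (p:ℝ) ≤ n := by nlinarith
    exact_mod_cast this
  have hNZ : NeZero (2 * m) := ⟨by omega⟩
  have hU := union_count n m (by omega) (by omega) p (by omega) hpn hp1
  refine tprob_ge n hn _ (fun ω => ∀ g < m, ‖Wg n (2 * m) g ω‖ ≤ bet n m p g) ?_ (by convert hU)
  intro ω hω
  have hB := (good_bound n m q (2 * m) (by omega) (by omega) rfl ω _ hω).trans
    (prod_bound n m p hn hm hmp (by omega))
  have hF := final_num n m p hn hm (by nlinarith) hl
  rw [← hq] at hF
  refine le_trans ?_ hF
  set X : ℝ := Dc * Real.exp 2 * (Real.sqrt (p * n) * n / m) with hX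
  have hX0 : 0 ≤ X := by
    have : 0 ≤ Dc := by linarith
    positivity
  have hexp : (4:ℝ) / q = (m:ℝ)⁻¹ := by rw [hq']; field_simp
  rw [hexp]
  calc _ ≤ (X ^ m) ^ ((m:ℝ)⁻¹) :=
        Real.rpow_le_rpow (opNorm_nonneg _) hB (by positivity)
    _ = X := Real.pow_rpow_inv_natCast hX0 (by omega)

end KB

theorem stmt_17 : ∃ C c : ℝ, 0 < C ∧ 0 < c ∧
    ∀ (n q k : ℕ), C ≤ (n : ℝ) → q = 4 * 2 ^ k → (q : ℝ) * Real.log n ≤ (n : ℝ) →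
      1 - (n : ℝ) ^ (-c) ≤
        tprob n 3 (fun A =>
          opNorm (fun I J : Fin (q / 2) → Fin n => Bmat n q A I J) ^ ((4 : ℝ) / (q : ℝ)) ≤
            (n : ℝ) ^ ((3 : ℝ) / 2) * Real.log n ^ 5 / Real.sqrt q) :=
  KB.main17
end
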